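/- Let ℓ, m be positive integers. If A ⊆ ℕ has upper Banach density d*(A) > 1 − 1/(ℓ+m), then there is an infinite set B ⊆ ℕ such that {m·b₁ + ℓ·b₂ : b₁, b₂ ∈ B and b₁ < b₂} ⊆ A. Moreover, this density threshold cannot be improved: the set A = ℕ \ (ℓ+m)ℕ has natural density 1 − 1/(ℓ+m) and contains no set of the form {m·b₁ + ℓ·b₂ : b₁, b₂ ∈ B and b₁ < b₂} for any infinite B ⊆ ℕ. -/

import Mathlib

open Filter MeasureTheory Topology

open scoped Classical in
/-- Upper Banach density: `limsup` over window length `N` of the maximal count of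
elements of `A` in a window of length `N`, divided by `N`. -/
noncomputable def upperBanachDensity (A : Set ℕ) : ℝ :=
  Filter.limsup
    (fun N : ℕ => ⨆ M : ℕ, (((Finset.Ico M (M + N)).filter (· ∈ A)).card : ℝ) / N)
    Filter.atTop

open scoped Classical in
/-- Natural upper density of a set of naturals. -/
noncomputable def upperDensity (A : Set ℕ) : ℝ :=
  Filter.limsup (fun N : ℕ => (((Finset.Icc 1 N).filter (· ∈ A)).card : ℝ) / N)
    Filter.atTop

open scoped Classical in
/-- Natural lower density of a set of naturals. -/
noncomputable def lowerDensity (A : Set ℕ) : ℝ :=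
  Filter.liminf (fun N : ℕ => (((Finset.Icc 1 N).filter (· ∈ A)).card : ℝ) / N)
    Filter.atTop

open Filter MeasureTheory Topology

/-- bounded sequence -/
def BddSeq (f : ℕ → ℂ) : Prop := ∃ C : ℝ, ∀ n, ‖f n‖ ≤ C

lemma BddSeq.const (c : ℂ) : BddSeq (fun _ => c) := ⟨‖c‖, fun _ => le_rfl⟩

lemma BddSeq.add {f g : ℕ → ℂ} (hf : BddSeq f) (hg : BddSeq g) :
    BddSeq (fun n => f n + g n) := by
  obtain ⟨C, hC⟩ := hf
  obtain ⟨D, hD⟩ := hg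
  exact ⟨C + D, fun n => (norm_add_le _ _).trans (add_le_add (hC n) (hD n))⟩

lemma BddSeq.mul {f g : ℕ → ℂ} (hf : BddSeq f) (hg : BddSeq g) :
    BddSeq (fun n => f n * g n) := by
  obtain ⟨C, hC⟩ := hf
  obtain ⟨D, hD⟩ := hg
  refine ⟨C * D, fun n => ?_⟩
  rw [norm_mul]
  exact mul_le_mul (hC n) (hD n) (norm_nonneg _) ((norm_nonneg _).trans (hC n))

lemma BddSeq.shift {f : ℕ → ℂ} (hf : BddSeq f) (k : ℕ) : BddSeq (fun n => f (n + k)) := by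
  obtain ⟨C, hC⟩ := hf
  exact ⟨C, fun n => hC _⟩

lemma BddSeq.neg {f : ℕ → ℂ} (hf : BddSeq f) : BddSeq (fun n => - f n) := by
  obtain ⟨C, hC⟩ := hf
  exact ⟨C, fun n => by rw [norm_neg]; exact hC n⟩

lemma BddSeq.sub {f g : ℕ → ℂ} (hf : BddSeq f) (hg : BddSeq g) :
    BddSeq (fun n => f n - g n) := by
  simpa [sub_eq_add_neg] using hf.add hg.neg

lemma BddSeq.sum {ι : Type*} (s : Finset ι) {f : ι → ℕ → ℂ} (hf : ∀ i ∈ s, BddSeq (f i)) :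
    BddSeq (fun n => ∑ i ∈ s, f i n) := by
  classical
  induction s using Finset.induction_on with
  | empty => simpa using BddSeq.const 0
  | insert a s ha ih =>
    simp only [Finset.sum_insert ha]
    exact (hf a (by simp)).add (ih fun i hi => hf i (by simp [hi]))

/-- An invariant mean -/
structure IsMean (E : (ℕ → ℂ) →ₗ[ℂ] ℂ) : Prop where
  one : E (fun _ => 1) = 1
  shift1 : ∀ f, BddSeq f → E (fun n => f (n + 1)) = E f
  mono : ∀ (f : ℕ → ℂ) (g : ℕ → ℝ), (∃ C, ∀ n, g n ≤ C) → (∀ n, ‖f n‖ ≤ g n) →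
    ‖E f‖ ≤ (E (fun n => (g n : ℂ))).re

namespace IsMean
variable {E : (ℕ → ℂ) →ₗ[ℂ] ℂ} (hE : IsMean E)
include hE

lemma const (c : ℂ) : E (fun _ => c) = c := by
  have : (fun _ : ℕ => c) = c • (fun _ : ℕ => (1 : ℂ)) := by ext; simp
  rw [this, map_smul, hE.one]; simp

omit hE in
lemma add_fun (f g : ℕ → ℂ) : E (fun n => f n + g n) = E f + E g := map_add E f g

omit hE in
lemma sub_fun (f g : ℕ → ℂ) : E (fun n => f n - g n) = E f - E g := map_sub E f g

omit hE in
lemma smul_fun (c : ℂ) (f : ℕ → ℂ) : E (fun n => c * f n) = c * E f := map_smul E c f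

omit hE in
lemma mul_const (c : ℂ) (f : ℕ → ℂ) : E (fun n => f n * c) = E f * c := by
  simp_rw [mul_comm _ c]; exact map_smul E c f

omit hE in
lemma sum_fun {ι : Type*} (s : Finset ι) (f : ι → ℕ → ℂ) :
    E (fun n => ∑ i ∈ s, f i n) = ∑ i ∈ s, E (f i) := by
  rw [← map_sum]; congr 1; ext n; simp

lemma norm_le {f : ℕ → ℂ} {C : ℝ} (h : ∀ n, ‖f n‖ ≤ C) : ‖E f‖ ≤ C := by
  have := hE.mono f (fun _ => C) ⟨C, fun _ => le_rfl⟩ h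
  rwa [hE.const, Complex.ofReal_re] at this

lemma shift {f : ℕ → ℂ} (hf : BddSeq f) (k : ℕ) : E (fun n => f (n + k)) = E f := by
  induction k with
  | zero => rfl
  | succ k ih =>
    rw [← ih, ← hE.shift1 _ (hf.shift k)]
    congr 1; ext n; congr 1; omega

lemma nonneg {g : ℕ → ℝ} (hb : ∃ C, ∀ n, g n ≤ C) (h : ∀ n, 0 ≤ g n) :
    0 ≤ (E (fun n => (g n : ℂ))).re ∧ (E (fun n => (g n : ℂ))).im = 0 := by
  have h1 := hE.mono (fun n => (g n : ℂ)) g hb (fun n => by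
    rw [Complex.norm_real, Real.norm_of_nonneg (h n)])
  set z := E (fun n => (g n : ℂ))
  have h2 : 0 ≤ z.re := (norm_nonneg _).trans h1
  refine ⟨h2, ?_⟩
  have h3 : ‖z‖ = |z.re| := le_antisymm (h1.trans (le_abs_self _)) (Complex.abs_re_le_norm z)
  exact (Complex.abs_re_eq_norm.mp h3.symm)

lemma real_im {g : ℕ → ℝ} (hb : ∃ C, ∀ n, |g n| ≤ C) :
    (E (fun n => (g n : ℂ))).im = 0 := by
  obtain ⟨C, hC⟩ := hb
  have := (hE.nonneg (g := fun n => g n + C) ⟨C + C, fun n => by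
    have := abs_le.mp (hC n); simp; linarith⟩ (fun n => by
    have := abs_le.mp (hC n); simp; linarith)).2
  have h2 : (fun n => ((g n + C : ℝ) : ℂ)) = fun n => (g n : ℂ) + (C : ℂ) := by ext; simp
  rw [h2, add_fun, hE.const] at this
  simpa using this

lemma real_eq {g : ℕ → ℝ} (hb : ∃ C, ∀ n, |g n| ≤ C) :
    E (fun n => (g n : ℂ)) = ((E (fun n => (g n : ℂ))).re : ℂ) :=
  Complex.ext (by simp) (by simpa using hE.real_im hb)

lemma le_of_le {f g : ℕ → ℝ} (hf : ∃ C, ∀ n, |f n| ≤ C) (hg : ∃ C, ∀ n, |g n| ≤ C)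
    (h : ∀ n, f n ≤ g n) : (E (fun n => (f n : ℂ))).re ≤ (E (fun n => (g n : ℂ))).re := by
  obtain ⟨C, hC⟩ := hf
  obtain ⟨D, hD⟩ := hg
  have := (hE.nonneg (g := fun n => g n - f n) ⟨C + D, fun n => by
    have := abs_le.mp (hC n); have := abs_le.mp (hD n); simp; linarith⟩ (fun n => by
    simpa using h n)).1
  have h2 : (fun n => ((g n - f n : ℝ) : ℂ)) = fun n => (g n : ℂ) - (f n : ℂ) := by ext; simp
  rw [h2, sub_fun] at this
  simpa using this

lemma conj {f : ℕ → ℂ} (hf : BddSeq f) :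
    E (fun n => (starRingEnd ℂ) (f n)) = (starRingEnd ℂ) (E f) := by
  obtain ⟨C, hC⟩ := hf
  have h1 : f = fun n => ((f n).re : ℂ) + Complex.I * ((f n).im : ℂ) := by
    ext n; rw [mul_comm]; simp
  have h2 : (fun n => (starRingEnd ℂ) (f n)) =
      fun n => ((f n).re : ℂ) - Complex.I * ((f n).im : ℂ) := by
    ext n; apply Complex.ext <;> simp
  have r1 := hE.real_im (g := fun n => (f n).re) ⟨C, fun n => (Complex.abs_re_le_norm _).trans (hC n)⟩
  have r2 := hE.real_im (g := fun n => (f n).im) ⟨C, fun n => (Complex.abs_im_le_norm _).trans (hC n)⟩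
  rw [h2, sub_fun, smul_fun]
  conv_rhs => rw [h1, add_fun, smul_fun]
  apply Complex.ext <;> simp [r1, r2]

/-- equality of eventually equal sequences -/
lemma congr_tail {f g : ℕ → ℂ} (hf : BddSeq f) (hg : BddSeq g) (W : ℕ)
    (h : ∀ n ≥ W, f n = g n) : E f = E g := by
  rw [← hE.shift hf W, ← hE.shift hg W]
  congr 1; ext n; exact h _ (by omega)

lemma zero_mul_of_sq {f : ℕ → ℂ} (hf : BddSeq f) {a : ℕ → ℂ} (ha : BddSeq a)
    (h : E (fun n => ((‖f n‖ ^ 2 : ℝ) : ℂ)) = 0) : E (fun n => a n * f n) = 0 := by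
  obtain ⟨C, hC⟩ := ha
  obtain ⟨D, hD⟩ := hf
  have hC0 : 0 ≤ C := (norm_nonneg _).trans (hC 0)
  rw [← norm_le_zero_iff]
  refine le_of_forall_pos_le_add fun e he => ?_
  -- |a f| ≤ e + C^2/(4 * e) |f|^2
  have key := hE.mono (fun n => a n * f n) (fun n => e + C ^ 2 / (4 * e) * ‖f n‖ ^ 2)
    ⟨e + C ^ 2 / (4 * e) * D ^ 2, fun n => by
      have := hD n; gcongr⟩ (fun n => by
      rw [norm_mul]
      have h1 : ‖a n‖ * ‖f n‖ ≤ C * ‖f n‖ := by gcongr; exact hC n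
      refine h1.trans ?_
      have : 0 ≤ (e - C * ‖f n‖ / 2) ^ 2 / e := by positivity
      have h2 : (e - C * ‖f n‖ / 2) ^ 2 / e = e + C ^ 2 / (4 * e) * ‖f n‖ ^ 2 - C * ‖f n‖ := by
        field_simp; ring
      linarith)
  have h3 : (fun n => ((e + C ^ 2 / (4 * e) * ‖f n‖ ^ 2 : ℝ) : ℂ)) =
    fun n => (e : ℂ) + ((C ^ 2 / (4 * e) : ℝ) : ℂ) * ((‖f n‖ ^ 2 : ℝ) : ℂ) := by
    ext n; push_cast; ring
  rw [h3, add_fun, smul_fun, hE.const, h] at key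
  simpa using key

lemma char_zero {z : ℂ} (hz : ‖z‖ = 1) (h1 : z ≠ 1) : E (fun n => z ^ n) = 0 := by
  have hb : BddSeq (fun n => z ^ n) := ⟨1, fun n => by simp [hz]⟩
  have := hE.shift1 _ hb
  simp_rw [pow_succ'] at this
  rw [smul_fun] at this
  have h2 : (z - 1) * E (fun n => z ^ n) = 0 := by rw [sub_mul, this]; ring
  exact (mul_eq_zero.mp h2).resolve_left (sub_ne_zero.mpr h1)

end IsMean

open Filter MeasureTheory Topology

section compactop
variable {H : Type*} [NormedAddCommGroup H] [InnerProductSpace ℂ H] [CompleteSpace H]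

open scoped Classical in
lemma compact_of_trace (O : H →L[ℂ] H) (hsym : O.IsSymmetric)
    (hpos : ∀ x, 0 ≤ (inner ℂ (O x) x).re) (C : ℝ)
    (hC : ∀ s : Finset H, (∀ v ∈ s, ∀ w ∈ s, inner ℂ v w = if v = w then (1 : ℂ) else 0) →
      ∑ x ∈ s, (inner ℂ (O x) x).re ≤ C) : IsCompactOperator O := by
  -- near maximal families
  have step1 : ∀ e > 0, ∃ F : Submodule ℂ H, FiniteDimensional ℂ F ∧
      ∀ x ∈ Fᗮ, (inner ℂ (O x) x).re ≤ e * ‖x‖ ^ 2 := by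
    intro e he
    let T : Set ℝ := {r | ∃ s : Finset H,
      (∀ v ∈ s, ∀ w ∈ s, inner ℂ v w = if v = w then (1 : ℂ) else 0) ∧
      ∑ x ∈ s, (inner ℂ (O x) x).re = r}
    have hTne : T.Nonempty := ⟨0, ∅, by simp, by simp⟩
    have hTb : BddAbove T := ⟨C, by rintro r ⟨s, hs, rfl⟩; exact hC s hs⟩
    obtain ⟨r, ⟨s, hs, rfl⟩, hr⟩ := exists_lt_of_lt_csSup hTne (sub_lt_self (sSup T) he)
    refine ⟨Submodule.span ℂ (s : Set H), FiniteDimensional.span_finset ℂ s, ?_⟩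
    have unit : ∀ x ∈ (Submodule.span ℂ (s : Set H))ᗮ, ‖x‖ = 1 → (inner ℂ (O x) x).re ≤ e := by
      intro x hx hx1
      have hort : ∀ v ∈ s, inner ℂ v x = (0 : ℂ) := fun v hv =>
        (Submodule.mem_orthogonal _ _).mp hx v (Submodule.subset_span hv)
      have hort' : ∀ v ∈ s, inner ℂ x v = (0 : ℂ) := fun v hv => inner_eq_zero_symm.mp (hort v hv)
      have hxx : inner ℂ x x = (1 : ℂ) := by rw [inner_self_eq_norm_sq_to_K, hx1]; simp
      have hxs : x ∉ s := by
        intro h; have := hort x h; rw [hxx] at this; exact one_ne_zero this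
      have hmem : ∑ y ∈ insert x s, (inner ℂ (O y) y).re ∈ T := by
        refine ⟨insert x s, ?_, rfl⟩
        intro v hv w hw
        rcases Finset.mem_insert.mp hv with rfl | hv' <;>
        rcases Finset.mem_insert.mp hw with rfl | hw'
        · rw [if_pos rfl, hxx]
        · rw [if_neg (by rintro rfl; exact hxs hw'), hort' _ hw']
        · rw [if_neg (by rintro rfl; exact hxs hv'), hort _ hv']
        · exact hs v hv' w hw'
      have := le_csSup hTb hmem
      rw [Finset.sum_insert hxs] at this
      linarith
    intro x hx
    by_cases hx0 : x = 0
    · simp [hx0]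
    have hn : 0 < ‖x‖ := norm_pos_iff.mpr hx0
    have h1 := unit (((‖x‖⁻¹ : ℝ) : ℂ) • x) (Submodule.smul_mem _ _ hx) (by
      rw [norm_smul]; simp [hn.ne'])
    rw [map_smul, inner_smul_left, inner_smul_right, Complex.conj_ofReal, ← mul_assoc,
      ← Complex.ofReal_mul, Complex.re_ofReal_mul] at h1
    have : (inner ℂ (O x) x).re = ‖x‖ ^ 2 * (‖x‖⁻¹ * ‖x‖⁻¹ * (inner ℂ (O x) x).re) := by
      field_simp
    rw [this, mul_comm e]
    gcongr
  have step2 : ∀ x, ‖O x‖ ^ 2 ≤ (‖O‖ + 1) * (inner ℂ (O x) x).re := by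
    intro x
    set t : ℝ := (‖O‖ + 1)⁻¹ with ht
    have hO : 0 < ‖O‖ + 1 := by positivity
    have h1 := hpos (x - (t : ℂ) • O x)
    have h2 : inner ℂ (O (O x)) x = inner ℂ (O x) (O x) := hsym (O x) x
    have h3 : (inner ℂ (O x) (O x) : ℂ) = ((‖O x‖ ^ 2 : ℝ) : ℂ) := by
      rw [inner_self_eq_norm_sq_to_K]; simp
    rw [map_sub, map_smul, inner_sub_left, inner_sub_right, inner_sub_right, inner_smul_left,
      inner_smul_right, inner_smul_left, inner_smul_right, h2, h3, Complex.conj_ofReal] at h1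
    simp only [Complex.sub_re, Complex.re_ofReal_mul, Complex.ofReal_re] at h1
    have h4 : (inner ℂ (O (O x)) (O x)).re ≤ ‖O‖ * ‖O x‖ ^ 2 := by
      refine (Complex.re_le_norm _).trans ((norm_inner_le_norm _ _).trans ?_)
      have := O.le_opNorm (O x)
      nlinarith [norm_nonneg (O x)]
    have ht0 : 0 < t := by positivity
    have h5 : t * (‖O‖ + 1) = 1 := by rw [ht]; field_simp
    have h6 : t * (inner ℂ (O (O x)) (O x)).re ≤ ‖O x‖ ^ 2 := by
      calc t * (inner ℂ (O (O x)) (O x)).re ≤ t * (‖O‖ * ‖O x‖ ^ 2) := by gcongr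
        _ ≤ t * (‖O‖ + 1) * ‖O x‖ ^ 2 := by nlinarith [sq_nonneg (‖O x‖)]
        _ = _ := by rw [h5, one_mul]
    have h7 : t * (t * (inner ℂ (O (O x)) (O x)).re) ≤ t * ‖O x‖ ^ 2 := by gcongr
    have h8 : t * ‖O x‖ ^ 2 ≤ (inner ℂ (O x) x).re := by linarith
    calc ‖O x‖ ^ 2 = (‖O‖ + 1) * (t * ‖O x‖ ^ 2) := by rw [← mul_assoc, mul_comm _ t, h5, one_mul]
      _ ≤ _ := by gcongr
  have hcl := isClosed_setOfPred_isCompactOperator (σ₁₂ := RingHom.id ℂ) (M₁ := H) (M₂ := H)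
  have : O ∈ closure {f : H →L[ℂ] H | IsCompactOperator f} := by
    rw [Metric.mem_closure_iff]
    intro e he
    obtain ⟨F, hF, hFe⟩ := step1 ((e / 4) ^ 2 / (‖O‖ + 1)) (by positivity)
    refine ⟨O ∘L F.starProjection, ?_, ?_⟩
    · have : IsCompactOperator (F.starProjection) := by
        have h : (F.starProjection : H → H) = F.subtypeL ∘ F.orthogonalProjectionOnto := rfl
        rw [h]
        have : ProperSpace F := FiniteDimensional.proper ℂ F
        have h3 : IsCompactOperator (F.orthogonalProjectionOnto) :=
          isCompactOperator_of_locallyCompactSpace_dom F.orthogonalProjectionOnto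
        exact IsCompactOperator.clm_comp h3 F.subtypeL
      exact IsCompactOperator.clm_comp this O
    · rw [dist_eq_norm]
      refine lt_of_le_of_lt (ContinuousLinearMap.opNorm_le_bound _ (M := e / 2) (by positivity) ?_)
        (by linarith)
      intro x
      have h1 : (O - O ∘L F.starProjection) x = O (x - F.starProjection x) := by simp
      rw [h1]
      set y := x - F.starProjection x
      have hy : y ∈ Fᗮ := Submodule.sub_starProjection_mem_orthogonal x
      have hyn : ‖y‖ ≤ 2 * ‖x‖ := by
        have h1 : ‖F.starProjection x‖ ≤ 1 * ‖x‖ :=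
          (F.starProjection.le_opNorm x).trans (by gcongr; exact F.starProjection_norm_le)
        have := norm_sub_le x (F.starProjection x)
        linarith
      have h2 : ‖O y‖ ^ 2 ≤ (e / 4 * ‖y‖) ^ 2 := by
        refine (step2 y).trans ?_
        calc _ ≤ (‖O‖ + 1) * ((e / 4) ^ 2 / (‖O‖ + 1) * ‖y‖ ^ 2) := by
              gcongr; exact hFe y hy
          _ = _ := by field_simp
      have h3 := abs_le_of_sq_le_sq h2 (by positivity)
      rw [abs_of_nonneg (norm_nonneg _)] at h3
      nlinarith
  rwa [hcl.closure_eq] at this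


lemma weak_mixing {E : (ℕ → ℂ) →ₗ[ℂ] ℂ} (hE : IsMean E) (V : H →ₗᵢ[ℂ] H) (w : ℕ → H) (l : ℕ)
    (hw : ∀ n, w (n + l) = V (w n)) (C : ℝ) (hC : ∀ n, ‖w n‖ ≤ C)
    (hort : ∀ n ξ (c : ℂ), V ξ = c • ξ → inner ℂ ξ (w n) = (0 : ℂ)) (g : H) :
    E (fun n => ((‖inner ℂ g (w n)‖ ^ 2 : ℝ) : ℂ)) = 0 := by
  have hC0 : 0 ≤ C := (norm_nonneg _).trans (hC 0)
  have hbd : ∀ x, BddSeq (fun n => inner ℂ x (w n)) := fun x =>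
    ⟨‖x‖ * C, fun n => (norm_inner_le_norm _ _).trans (by gcongr; exact hC n)⟩
  have hbd' : ∀ x, BddSeq (fun n => inner ℂ (w n) x) := fun x =>
    ⟨C * ‖x‖, fun n => (norm_inner_le_norm _ _).trans (by gcongr; exact hC n)⟩
  let B0 : H →ₗ⋆[ℂ] H →ₗ[ℂ] ℂ := LinearMap.mk₂'ₛₗ (starRingEnd ℂ) (RingHom.id ℂ)
    (fun x y => E (fun n => inner ℂ x (w n) * inner ℂ (w n) y))
    (fun x x' y => by simp_rw [inner_add_left, add_mul]; exact IsMean.add_fun _ _)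
    (fun c x y => by simp_rw [inner_smul_left, mul_assoc]; exact IsMean.smul_fun _ _)
    (fun x y y' => by simp_rw [inner_add_right, mul_add]; exact IsMean.add_fun _ _)
    (fun c x y => by
      simp_rw [inner_smul_right, mul_left_comm _ c]; exact IsMean.smul_fun _ _)
  let B : H →L⋆[ℂ] H →L[ℂ] ℂ := B0.mkContinuous₂ (C * C) (fun x y => by
    refine hE.norm_le fun n => ?_
    rw [norm_mul]
    calc _ ≤ (‖x‖ * ‖w n‖) * (‖w n‖ * ‖y‖) := by
          gcongr <;> exact norm_inner_le_norm _ _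
      _ ≤ (‖x‖ * C) * (C * ‖y‖) := by gcongr <;> exact hC n
      _ = _ := by ring)
  let O : H →L[ℂ] H := InnerProductSpace.continuousLinearMapOfBilin B
  have hO : ∀ x y, inner ℂ (O x) y = E (fun n => inner ℂ x (w n) * inner ℂ (w n) y) := fun x y =>
    InnerProductSpace.continuousLinearMapOfBilin_apply B x y
  have hOd : ∀ x, inner ℂ (O x) x = E (fun n => ((‖inner ℂ x (w n)‖ ^ 2 : ℝ) : ℂ)) := by
    intro x
    rw [hO]
    congr 1; ext n
    rw [← inner_conj_symm (w n) x, Complex.mul_conj, Complex.normSq_eq_norm_sq]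
  have hsym : O.IsSymmetric := by
    intro x y
    change inner ℂ (O x) y = inner ℂ x (O y)
    rw [← inner_conj_symm x (O y), hO, hO, ← hE.conj ((hbd y).mul (hbd' x))]
    congr 1; ext n
    rw [map_mul, inner_conj_symm, inner_conj_symm, mul_comm]
  have hpos : ∀ x, 0 ≤ (inner ℂ (O x) x).re := by
    intro x
    rw [hOd]
    refine (hE.nonneg ⟨(‖x‖ * C) ^ 2, fun n => ?_⟩ fun n => by positivity).1
    have := (norm_inner_le_norm (𝕜 := ℂ) x (w n)).trans
      (by gcongr; exact hC n : ‖x‖ * ‖w n‖ ≤ ‖x‖ * C)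
    gcongr
  have hcomp : IsCompactOperator O := by
    classical
    refine compact_of_trace O hsym hpos (C ^ 2) ?_
    intro s hs
    have hon : Orthonormal ℂ (fun x : {x // x ∈ (s : Set H)} => (x : H)) := by
      rw [orthonormal_subtype_iff_ite]
      intro v hv w hw; convert hs v hv w hw
    have h1 : ∑ x ∈ s, (inner ℂ (O x) x).re =
        (E (fun n => ((∑ x ∈ s, ‖inner ℂ x (w n)‖ ^ 2 : ℝ) : ℂ))).re := by
      simp_rw [Complex.ofReal_sum]
      rw [IsMean.sum_fun, Complex.re_sum]
      exact Finset.sum_congr rfl fun x _ => by rw [hOd]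
    rw [h1]
    refine (Complex.re_le_norm _).trans (hE.norm_le fun n => ?_)
    rw [Complex.norm_real, Real.norm_of_nonneg (by positivity)]
    have h2 := hon.sum_inner_products_le (w n) (s := (Finset.univ : Finset {x // x ∈ s}))
    rw [← Finset.sum_coe_sort s]
    refine h2.trans ?_
    have := hC n
    gcongr
  have hVO : ∀ x, O (V x) = V (O x) := by
    intro x
    refine ext_inner_right ℂ fun y => ?_
    rw [hO, ← hE.shift ((hbd _).mul (hbd' _)) l]
    have h1 : inner ℂ (V (O x)) y = inner ℂ (O x)
        (ContinuousLinearMap.adjoint V.toContinuousLinearMap y) := by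
      rw [ContinuousLinearMap.adjoint_inner_right]; rfl
    rw [h1, hO]
    congr 1; ext n
    rw [hw, ContinuousLinearMap.adjoint_inner_right]
    simp
  have hO0 : O = 0 := by
    rw [← ContinuousLinearMap.eq_zero_of_forall_hasEigenvalue_eq_zero hcomp hsym]
    intro μ hμ
    by_contra hμ0
    have hfd := ContinuousLinearMap.finite_dimensional_eigenspace hcomp μ hμ0
    have hinv : ∀ x ∈ Module.End.eigenspace O.toLinearMap μ,
        V.toLinearMap x ∈ Module.End.eigenspace O.toLinearMap μ := by
      intro x hx
      rw [Module.End.mem_eigenspace_iff] at hx ⊢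
      change O x = _ at hx
      change O (V x) = μ • V x
      rw [hVO, hx, map_smul]
    have hnt : Nontrivial (Module.End.eigenspace O.toLinearMap μ) :=
      Submodule.nontrivial_iff_ne_bot.mpr hμ
    obtain ⟨c, hc⟩ := Module.End.exists_eigenvalue (V.toLinearMap.restrict hinv)
    obtain ⟨ξ, hξ⟩ := hc.exists_hasEigenvector
    have hξ1 : V (ξ : H) = c • (ξ : H) := congrArg Subtype.val hξ.apply_eq_smul
    have hξ0 : (ξ : H) ≠ 0 := fun h => hξ.2 (Subtype.ext h)
    have h2 : O (ξ : H) = μ • (ξ : H) := Module.End.mem_eigenspace_iff.mp ξ.2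
    have h3 := hO ξ ξ
    simp_rw [hort _ _ c hξ1, zero_mul] at h3
    rw [hE.const, h2, inner_smul_left] at h3
    rcases mul_eq_zero.mp h3 with h | h
    · exact hμ0 (by simpa using h)
    · exact hξ0 (inner_self_eq_zero.mp h)
  rw [← hOd, hO0]
  simp

end compactop

open Filter MeasureTheory Topology

section decomposition
variable {H : Type*} [NormedAddCommGroup H] [InnerProductSpace ℂ H]

/-- the space of trigonometric sequences -/
def trigSpace (H : Type*) [NormedAddCommGroup H] [InnerProductSpace ℂ H] : Submodule ℂ (ℕ → H) :=
  Submodule.span ℂ {f | ∃ z : ℂ, ‖z‖ = 1 ∧ ∃ h : H, f = fun n => z ^ n • h}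

lemma trigSpace_finite {f : ℕ → H} (hf : f ∈ trigSpace H) :
    ∃ (s : Finset Circle) (h : Circle → H), ∀ n, f n = ∑ z ∈ s, ((z : ℂ) ^ n) • h z := by
  have : ∃ h : Circle →₀ H, ∀ n, f n = h.sum (fun z x => ((z : ℂ) ^ n) • x) := by
    induction hf using Submodule.span_induction with
    | mem f hf =>
      obtain ⟨z, hz, h, rfl⟩ := hf
      obtain ⟨u, hu⟩ : ∃ u : Circle, (u : ℂ) = z := ⟨⟨z, mem_sphere_zero_iff_norm.2 hz⟩, rfl⟩
      refine ⟨Finsupp.single u h, fun n => ?_⟩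
      rw [Finsupp.sum_single_index (by simp), hu]
    | zero => exact ⟨0, fun n => by simp⟩
    | add f g _ _ hf hg =>
      obtain ⟨a, ha⟩ := hf
      obtain ⟨b, hb⟩ := hg
      refine ⟨a + b, fun n => ?_⟩
      rw [Finsupp.sum_add_index' (by simp) (by intros; simp), Pi.add_apply, ha, hb]
    | smul c f _ hf =>
      obtain ⟨a, ha⟩ := hf
      refine ⟨c • a, fun n => ?_⟩
      rw [Finsupp.sum_smul_index' (by simp), Pi.smul_apply, ha, Finsupp.smul_sum]
      exact Finsupp.sum_congr fun z _ => smul_comm _ _ _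
  obtain ⟨h, hh⟩ := this
  exact ⟨h.support, h, hh⟩

lemma trig_residue (l : ℕ) (hl : 0 < l) (c : ℕ) (hc : c < l) (a : ℂ) (ha : ‖a‖ = 1) (x : H) :
    (fun n : ℕ => if n % l = c then a ^ (n / l) • x else 0) ∈ trigSpace H := by
  obtain ⟨z, hz⟩ := IsAlgClosed.exists_pow_nat_eq a hl
  have hz1 : ‖z‖ = 1 := by
    have : ‖z‖ ^ l = 1 := by rw [← norm_pow, hz, ha]
    exact (pow_eq_one_iff_of_nonneg (norm_nonneg _) hl.ne').mp this
  have hz0 : z ≠ 0 := by rintro rfl; simp at hz1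
  have hprim := Complex.isPrimitiveRoot_exp l hl.ne'
  set ω := Complex.exp (2 * Real.pi * Complex.I / l) with hω
  have hω1 : ‖ω‖ = 1 := hprim.norm'_eq_one hl.ne'
  have hω0 : ω ≠ 0 := by intro h; rw [h] at hω1; simp at hω1
  have hl0 : (l : ℂ) ≠ 0 := by exact_mod_cast hl.ne'
  have key : (fun n : ℕ => if n % l = c then a ^ (n / l) • x else 0) =
      ∑ j ∈ Finset.range l, (fun n : ℕ => (z * ω ^ j) ^ n •
        (((l : ℂ)⁻¹ * ((z * ω ^ j) ^ c)⁻¹) • x)) := by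
    ext n
    rw [Finset.sum_apply]
    simp_rw [smul_smul]
    rw [← Finset.sum_smul]
    have hn : l * (n / l) + n % l = n := Nat.div_add_mod n l
    have e1 : ∀ j, (z * ω ^ j) ^ n * ((l : ℂ)⁻¹ * ((z * ω ^ j) ^ c)⁻¹) =
        (l : ℂ)⁻¹ * (z ^ n * (z ^ c)⁻¹) * (ω ^ n * (ω ^ c)⁻¹) ^ j := by
      intro j
      have : ω ^ c ≠ 0 := pow_ne_zero _ hω0
      rw [mul_pow z, mul_pow z, mul_inv, mul_pow, inv_pow, ← pow_mul, ← pow_mul, ← pow_mul,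
        ← pow_mul, mul_comm j n, mul_comm j c]
      ring
    simp_rw [e1]
    rw [← Finset.mul_sum]
    split_ifs with h
    · have e2 : ω ^ n * (ω ^ c)⁻¹ = 1 := by
        have : ω ^ n = ω ^ c := by
          conv_lhs => rw [← hn, pow_add, pow_mul, hprim.pow_eq_one, one_pow, one_mul, h]
        rw [this, mul_inv_cancel₀ (pow_ne_zero _ hω0)]
      have e3 : z ^ n * (z ^ c)⁻¹ = a ^ (n / l) := by
        conv_lhs => rw [← hn, pow_add, pow_mul, hz, h]
        rw [mul_assoc, mul_inv_cancel₀ (pow_ne_zero _ hz0), mul_one]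
      rw [e2, e3]
      simp only [one_pow, Finset.sum_const, Finset.card_range, nsmul_eq_mul, mul_one]
      congr 1
      field_simp
    · have e2 : ω ^ n * (ω ^ c)⁻¹ ≠ 1 := by
        intro h1
        have h2 : ω ^ (n % l) = ω ^ c := by
          have : ω ^ n = ω ^ (n % l) := by
            conv_lhs => rw [← hn, pow_add, pow_mul, hprim.pow_eq_one, one_pow, one_mul]
          rw [← this]
          field_simp at h1
          exact h1
        exact h (hprim.pow_inj (Nat.mod_lt _ hl) hc h2)
      have e4 : (ω ^ n * (ω ^ c)⁻¹) ^ l = 1 := by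
        rw [mul_pow, inv_pow, ← pow_mul, ← pow_mul, mul_comm n, mul_comm c, pow_mul, pow_mul,
          hprim.pow_eq_one]
        simp
      have e5 : ∑ j ∈ Finset.range l, (ω ^ n * (ω ^ c)⁻¹) ^ j = 0 := by
        rw [geom_sum_eq e2, e4]; simp
      rw [e5]; simp
  rw [key]
  refine Submodule.sum_mem _ fun j _ => Submodule.subset_span ⟨z * ω ^ j, ?_, _, rfl⟩
  simp [hz1, hω1]

variable [CompleteSpace H]

lemma decomp {E : (ℕ → ℂ) →ₗ[ℂ] ℂ} (hE : IsMean E) (V : H →ₗᵢ[ℂ] H) (v : ℕ → H) (l : ℕ)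
    (hl : 0 < l) (hv : ∀ n, v (n + l) = V (v n)) (η : ℝ) (hη : 0 < η) :
    ∃ (s : Finset Circle) (h : Circle → H) (r w : ℕ → H),
      (∀ n, v n = (∑ z ∈ s, ((z : ℂ) ^ n) • h z) + r n + w n) ∧
      (∀ n, r (n + l) = V (r n)) ∧ (∀ n, ‖r n‖ ≤ η) ∧ (∃ C, ∀ n, ‖w n‖ ≤ C) ∧
      ∀ g, E (fun n => ((‖inner ℂ g (w n)‖ ^ 2 : ℝ) : ℂ)) = 0 := by
  let K0 : Submodule ℂ H := Submodule.span ℂ {ξ | ∃ c : ℂ, V ξ = c • ξ}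
  let K := K0.topologicalClosure
  have hKc : IsClosed (K : Set H) := K0.isClosed_topologicalClosure
  have : CompleteSpace K := hKc.completeSpace_coe
  -- choose approximations
  have hap : ∀ x : H, ∃ e ∈ K0, ‖K.starProjection x - e‖ ≤ η := by
    intro x
    have h1 : K.starProjection x ∈ closure (K0 : Set H) := by
      have := K.starProjection_apply_mem x
      exact this
    obtain ⟨e, he, hd⟩ := Metric.mem_closure_iff.mp h1 η hη
    exact ⟨e, he, by rw [← dist_eq_norm]; exact hd.le⟩
  choose ea hea1 hea2 using hap
  -- extension
  let ext : (ℕ → H) → ℕ → H := fun a n => V^[n / l] (a (n % l))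
  have ext_shift : ∀ a n, ext a (n + l) = V (ext a n) := by
    intro a n
    simp only [ext]
    rw [Nat.add_div_right _ hl, Nat.add_mod_right, Function.iterate_succ_apply']
  have ext_norm : ∀ a n, ‖ext a n‖ = ‖a (n % l)‖ := by
    intro a n
    simp only [ext]
    induction n / l with
    | zero => rfl
    | succ k ih => rw [Function.iterate_succ_apply', V.norm_map, ih]
  have it_add : ∀ k x y, V^[k] (x + y) = V^[k] x + V^[k] y := by
    intro k x y
    induction k with
    | zero => rfl
    | succ k ih => simp only [Function.iterate_succ_apply', ih, map_add]
  have v_ext : ∀ n, v n = ext v n := by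
    intro n
    have : ∀ k c, v (c + l * k) = V^[k] (v c) := by
      intro k c
      induction k with
      | zero => rfl
      | succ k ih => rw [Function.iterate_succ_apply', ← ih, ← hv]; congr 1; ring
    simp only [ext]
    rw [← this, Nat.mod_add_div]
  let ec : ℕ → H := fun c => ea (v c)
  let rc : ℕ → H := fun c => K.starProjection (v c) - ea (v c)
  let wc : ℕ → H := fun c => v c - K.starProjection (v c)
  have htrig : ext ec ∈ trigSpace H := by
    have h1 : ext ec = ∑ c ∈ Finset.range l,
        (fun n => if n % l = c then V^[n / l] (ec c) else 0) := by
      ext n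
      rw [Finset.sum_apply, Finset.sum_ite_eq, if_pos (Finset.mem_range.mpr (Nat.mod_lt _ hl))]
    rw [h1]
    refine Submodule.sum_mem _ fun c hc => ?_
    have hc := Finset.mem_range.mp hc
    have h2 : ∀ x ∈ K0, (fun n => if n % l = c then V^[n / l] x else 0) ∈ trigSpace H := by
      intro x hx
      induction hx using Submodule.span_induction with
      | mem x hx =>
        obtain ⟨a, ha⟩ := hx
        by_cases hx0 : x = 0
        · have : (fun n => if n % l = c then V^[n / l] x else 0) = 0 := by
            ext n
            have : ∀ k, V^[k] x = 0 := by
              intro k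
              induction k with
              | zero => exact hx0
              | succ k ih => rw [Function.iterate_succ_apply', ih, map_zero]
            simp [this]
          rw [this]; exact Submodule.zero_mem _
        have ha1 : ‖a‖ = 1 := by
          have h := congrArg norm ha
          rw [V.norm_map, norm_smul] at h
          have : 0 < ‖x‖ := norm_pos_iff.mpr hx0
          field_simp at h
          exact h.symm
        have : ∀ k, V^[k] x = a ^ k • x := by
          intro k
          induction k with
          | zero => simp
          | succ k ih =>
            rw [Function.iterate_succ_apply', ih, map_smul, ha, smul_smul, pow_succ]
        simp_rw [this]
        exact trig_residue l hl c hc a ha1 x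
      | zero =>
        have h0 : ∀ k, V^[k] (0 : H) = 0 := by
          intro k
          induction k with
          | zero => rfl
          | succ k ih => rw [Function.iterate_succ_apply', ih, map_zero]
        simp only [h0, ite_self]
        exact Submodule.zero_mem _
      | add x y _ _ hx hy =>
        convert Submodule.add_mem _ hx hy using 1
        ext n
        simp only [Pi.add_apply, it_add]
        split_ifs <;> simp
      | smul b x _ hx =>
        convert Submodule.smul_mem _ b hx using 1
        ext n
        have h0 : ∀ k, V^[k] (b • x) = b • V^[k] x := by
          intro k
          induction k with
          | zero => rfl
          | succ k ih => rw [Function.iterate_succ_apply', ih, map_smul,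
              Function.iterate_succ_apply']
        simp only [Pi.smul_apply, h0]
        split_ifs <;> simp
    exact h2 _ (hea1 _)
  obtain ⟨s, h, hs⟩ := trigSpace_finite htrig
  have hwC : ∀ n, ‖ext wc n‖ ≤ ∑ c ∈ Finset.range l, ‖wc c‖ := by
    intro n
    rw [ext_norm]
    exact Finset.single_le_sum (f := fun c => ‖wc c‖) (fun _ _ => norm_nonneg _)
      (Finset.mem_range.mpr (Nat.mod_lt n hl))
  refine ⟨s, h, ext rc, ext wc, ?_, ext_shift _, ?_, ⟨_, hwC⟩, ?_⟩
  · intro n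
    rw [← hs, v_ext]
    simp only [ext]
    rw [← it_add, ← it_add]
    congr 1
    simp only [ec, rc, wc]
    abel
  · intro n
    rw [ext_norm]
    exact hea2 _
  · intro g
    refine weak_mixing hE V (ext wc) l (ext_shift _) _ hwC ?_ g
    intro n ξ c hξ
    by_cases hx0 : ξ = 0
    · simp [hx0]
    have hc1 : ‖c‖ = 1 := by
      have h := congrArg norm hξ
      rw [V.norm_map, norm_smul] at h
      have : 0 < ‖ξ‖ := norm_pos_iff.mpr hx0
      field_simp at h
      exact h.symm
    have hc0 : c ≠ 0 := by intro h; rw [h] at hc1; simp at hc1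
    have base : ∀ j, inner ℂ ξ (wc j) = (0 : ℂ) := by
      intro j
      have h1 : wc j ∈ Kᗮ := Submodule.sub_starProjection_mem_orthogonal _
      exact (Submodule.mem_orthogonal _ _).mp h1 ξ
        (K0.le_topologicalClosure (Submodule.subset_span ⟨c, hξ⟩))
    simp only [ext]
    induction n / l with
    | zero => exact base _
    | succ k ih =>
      rw [Function.iterate_succ_apply']
      have h2 : inner ℂ (V ξ) (V (V^[k] (wc (n % l)))) = (0 : ℂ) := by
        rw [V.inner_map_map, ih]
      rw [hξ, inner_smul_left] at h2
      exact (mul_eq_zero.mp h2).resolve_left (by simpa using hc0)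

end decomposition

open Filter MeasureTheory Topology

section meanexist

/-- window averages -/
noncomputable def wavg (c L : ℕ → ℕ) (f : ℕ → ℂ) (i : ℕ) : ℂ :=
  ((L i : ℂ))⁻¹ * ∑ n ∈ Finset.range (L i), f (c i + n)

lemma wavg_norm_le (c L : ℕ → ℕ) (f : ℕ → ℂ) (C : ℝ) (hC : ∀ n, ‖f n‖ ≤ C) (i : ℕ) :
    ‖wavg c L f i‖ ≤ C := by
  have hC0 : 0 ≤ C := (norm_nonneg _).trans (hC 0)
  unfold wavg
  rw [norm_mul, norm_inv, Complex.norm_natCast]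
  by_cases h : L i = 0
  · simp [h, hC0]
  have h1 : ‖∑ n ∈ Finset.range (L i), f (c i + n)‖ ≤ L i * C := by
    refine (norm_sum_le _ _).trans ((Finset.sum_le_sum fun n _ => hC _).trans ?_)
    simp
  have : (0 : ℝ) < L i := by exact_mod_cast Nat.pos_of_ne_zero h
  rw [inv_mul_le_iff₀ this]
  exact h1

/-- subspace of bounded sequences -/
def bddSub : Submodule ℂ (ℕ → ℂ) where
  carrier := {f | BddSeq f}
  add_mem' := fun hf hg => hf.add hg
  zero_mem' := BddSeq.const 0
  smul_mem' := fun c _ hf => (BddSeq.const c).mul hf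

lemma wavg_tendsto (c L : ℕ → ℕ) (f : ℕ → ℂ) (hf : BddSeq f) :
    ∃ z, Tendsto (wavg c L f) (hyperfilter ℕ : Filter ℕ) (𝓝 z) := by
  obtain ⟨C, hC⟩ := hf
  have hcomp : IsCompact (Metric.closedBall (0 : ℂ) C) := isCompact_closedBall _ _
  have := isCompact_iff_ultrafilter_le_nhds.mp hcomp (Ultrafilter.map (wavg c L f) (hyperfilter ℕ))
    (by
      simp only [Ultrafilter.coe_map, le_principal_iff, mem_map]
      refine univ_mem' fun i => ?_
      simpa using wavg_norm_le c L f C hC i)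
  obtain ⟨z, _, hz⟩ := this
  exact ⟨z, hz⟩

lemma wavg_add (c L : ℕ → ℕ) (f g : ℕ → ℂ) (i : ℕ) :
    wavg c L (f + g) i = wavg c L f i + wavg c L g i := by
  simp [wavg, Finset.sum_add_distrib, mul_add]

lemma wavg_smul (c L : ℕ → ℕ) (a : ℂ) (f : ℕ → ℂ) (i : ℕ) :
    wavg c L (a • f) i = a * wavg c L f i := by
  simp only [wavg, Pi.smul_apply, smul_eq_mul, ← Finset.mul_sum]; ring

lemma exists_mean (c L : ℕ → ℕ) (hL : Tendsto L atTop atTop) :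
    ∃ E : (ℕ → ℂ) →ₗ[ℂ] ℂ, IsMean E ∧ ∀ g : ℕ → ℝ, (∃ C, ∀ n, |g n| ≤ C) → ∀ d : ℝ,
      (∀ i, d * L i ≤ ∑ n ∈ Finset.range (L i), g (c i + n)) → d ≤ (E (fun n => (g n : ℂ))).re := by
  classical
  choose! lim hlim using fun f hf => wavg_tendsto c L f hf
  have huniq : ∀ f, BddSeq f → ∀ z, Tendsto (wavg c L f) (hyperfilter ℕ : Filter ℕ) (𝓝 z) →
      lim f = z := fun f hf z hz => tendsto_nhds_unique (hlim f hf) hz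
  let E0 : bddSub →ₗ[ℂ] ℂ :=
    { toFun := fun f => lim f.1
      map_add' := fun f g => by
        refine huniq _ (f + g).2 _ ?_
        have := (hlim _ f.2).add (hlim _ g.2)
        refine this.congr fun i => ?_
        exact (wavg_add c L f.1 g.1 i).symm
      map_smul' := fun a f => by
        refine huniq _ (a • f).2 _ ?_
        have := (hlim _ f.2).const_mul a
        refine this.congr fun i => ?_
        exact (wavg_smul c L a f.1 i).symm }
  obtain ⟨E, hEE⟩ := E0.exists_extend
  have hE : ∀ f, BddSeq f → Tendsto (wavg c L f) (hyperfilter ℕ : Filter ℕ) (𝓝 (E f)) := by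
    intro f hf
    have : E f = lim f := by
      have := LinearMap.congr_fun hEE ⟨f, hf⟩
      exact this
    rw [this]; exact hlim f hf
  have hU : (hyperfilter ℕ : Filter ℕ) ≤ atTop := by
    rw [← Nat.cofinite_eq_atTop]; exact hyperfilter_le_cofinite
  have hLpos : ∀ᶠ i in (hyperfilter ℕ : Filter ℕ), 0 < L i :=
    hU (hL.eventually (eventually_gt_atTop 0))
  have hre : ∀ g : ℕ → ℝ, ∀ i, (wavg c L (fun n => (g n : ℂ)) i).re =
      (L i : ℝ)⁻¹ * ∑ n ∈ Finset.range (L i), g (c i + n) := by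
    intro g i
    have : wavg c L (fun n => (g n : ℂ)) i =
      (((L i : ℝ)⁻¹ * ∑ n ∈ Finset.range (L i), g (c i + n) : ℝ) : ℂ) := by
      simp [wavg]
    rw [this, Complex.ofReal_re]
  refine ⟨E, ⟨?_, ?_, ?_⟩, ?_⟩
  · refine tendsto_nhds_unique (hE _ (BddSeq.const 1)) ?_
    refine tendsto_const_nhds.congr' ?_
    filter_upwards [hLpos] with i hi
    have : (L i : ℂ) ≠ 0 := by exact_mod_cast hi.ne'
    simp [wavg, this]
  · intro f hf
    obtain ⟨C, hC⟩ := id hf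
    have h1 := (hE _ (hf.shift 1)).sub (hE _ hf)
    have h2 : Tendsto (fun i => wavg c L (fun n => f (n + 1)) i - wavg c L f i)
        (hyperfilter ℕ : Filter ℕ) (𝓝 0) := by
      have h3 : ∀ i, wavg c L (fun n => f (n + 1)) i - wavg c L f i =
          (L i : ℂ)⁻¹ * (f (c i + L i) - f (c i)) := by
        intro i
        simp only [wavg]
        rw [← mul_sub, ← Finset.sum_sub_distrib]
        congr 1
        exact Finset.sum_range_sub (fun n => f (c i + n)) (L i)
      refine squeeze_zero_norm (a := fun i => (L i : ℝ)⁻¹ * (C + C)) (fun i => ?_) ?_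
      · rw [h3, norm_mul, norm_inv, Complex.norm_natCast]
        gcongr
        exact (norm_sub_le _ _).trans (add_le_add (hC _) (hC _))
      · have h4 : Tendsto (fun i => (L i : ℝ)⁻¹ * (C + C)) atTop (𝓝 (0 * (C + C))) :=
          ((tendsto_inv_atTop_zero.comp (tendsto_natCast_atTop_atTop.comp hL))).mul_const _
        rw [zero_mul] at h4
        exact h4.mono_left hU
    exact sub_eq_zero.mp (tendsto_nhds_unique h1 h2)
  · rintro f g ⟨C, hC⟩ hfg
    have hf : BddSeq f := ⟨C, fun n => (hfg n).trans (hC n)⟩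
    have hg : BddSeq (fun n => (g n : ℂ)) := ⟨C, fun n => by
      rw [Complex.norm_real, Real.norm_of_nonneg ((norm_nonneg _).trans (hfg n))]; exact hC n⟩
    refine le_of_tendsto_of_tendsto' (hE f hf).norm
      ((Complex.continuous_re.tendsto _).comp (hE _ hg)) fun i => ?_
    simp only [Function.comp]
    rw [hre]
    simp only [wavg]
    rw [norm_mul, norm_inv, Complex.norm_natCast]
    gcongr
    exact (norm_sum_le _ _).trans (Finset.sum_le_sum fun n _ => hfg _)
  · rintro g ⟨C, hC⟩ d hd
    have hg : BddSeq (fun n => (g n : ℂ)) := ⟨C, fun n => by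
      rw [Complex.norm_real]; exact hC n⟩
    refine ge_of_tendsto ((Complex.continuous_re.tendsto _).comp (hE _ hg)) ?_
    filter_upwards [hLpos] with i hi
    simp only [Function.comp]
    rw [hre]
    have : (0 : ℝ) < L i := by exact_mod_cast hi
    rw [le_inv_mul_iff₀ this, mul_comm]
    exact hd i

end meanexist

/-- Borel structure on the Stone-Cech compactification -/
noncomputable instance instMeasUltra : MeasurableSpace (Ultrafilter ℕ) := borel _

instance instBorelUltra : BorelSpace (Ultrafilter ℕ) := ⟨rfl⟩

/-- The shift on the Stone-Cech compactification -/
def bshift (p : Ultrafilter ℕ) : Ultrafilter ℕ := Ultrafilter.map (· + 1) p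

lemma bshift_pure (n : ℕ) : bshift (pure n) = pure (n + 1) := rfl

lemma mem_bshift (s : Set ℕ) (p : Ultrafilter ℕ) : s ∈ bshift p ↔ {n | n + 1 ∈ s} ∈ p := Iff.rfl

lemma bshift_continuous : Continuous bshift := by
  rw [ultrafilterBasis_is_basis.continuous_iff]
  rintro _ ⟨s, rfl⟩
  exact ultrafilter_isOpen_basic {n | n + 1 ∈ s}

lemma bdd_of_cont (g : C(Ultrafilter ℕ, ℂ)) : BddSeq (fun n => g (pure n)) :=
  ⟨‖g‖, fun _ => g.norm_coe_le_norm _⟩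

lemma exists_measure {E : (ℕ → ℂ) →ₗ[ℂ] ℂ} (hE : IsMean E) :
    ∃ M : Measure (Ultrafilter ℕ), IsProbabilityMeasure M ∧ MeasurePreserving bshift M M ∧
      ∀ g : C(Ultrafilter ℕ, ℂ), ∫ p, g p ∂M = E (fun n => g (pure n)) := by
  have hbd : ∀ g : C(Ultrafilter ℕ, ℝ), ∃ C, ∀ n : ℕ, |g (pure n)| ≤ C := fun g =>
    ⟨‖g‖, fun _ => g.norm_coe_le_norm _⟩
  let Λ : CompactlySupportedContinuousMap (Ultrafilter ℕ) ℝ →ₚ[ℝ] ℝ :=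
    { toFun := fun f => (E (fun n => ((f (pure n) : ℝ) : ℂ))).re
      map_add' := fun f g => by
        rw [← Complex.add_re, ← IsMean.add_fun]; simp
      map_smul' := fun c f => by
        have : (fun n : ℕ => (((c • f) (pure n) : ℝ) : ℂ)) =
          fun n => (c : ℂ) * ((f (pure n) : ℝ) : ℂ) := by ext n; simp
        rw [this, IsMean.smul_fun]; simp
      monotone' := fun f g hfg =>
        hE.le_of_le (hbd f.toContinuousMap) (hbd g.toContinuousMap) (fun n => hfg _) }
  let M := RealRMK.rieszMeasure Λ
  have hreg : M.Regular := RealRMK.regular_rieszMeasure Λ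
  have hfin : IsFiniteMeasure M := inferInstance
  have hintg : ∀ g : C(Ultrafilter ℕ, ℝ), ∫ p, g p ∂M = (E (fun n => ((g (pure n) : ℝ) : ℂ))).re :=
    fun g => RealRMK.integral_rieszMeasure Λ
      { toContinuousMap := g, hasCompactSupport' := HasCompactSupport.of_compactSpace _ }
  have hprob : IsProbabilityMeasure M := by
    have h1 := hintg (ContinuousMap.const _ 1)
    simp only [ContinuousMap.const_apply, integral_const, smul_eq_mul, mul_one,
      Complex.ofReal_one] at h1
    rw [hE.one, Complex.one_re] at h1
    constructor
    rw [measureReal_def] at h1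
    exact (ENNReal.toReal_eq_one_iff _).mp h1
  have hcont : ∀ g : C(Ultrafilter ℕ, ℝ), Integrable g M := fun g =>
    g.continuous.integrable_of_hasCompactSupport (HasCompactSupport.of_compactSpace _)
  refine ⟨M, hprob, ⟨bshift_continuous.measurable, ?_⟩, ?_⟩
  · have hir : (M.map bshift).InnerRegular :=
      Measure.InnerRegular.map_of_continuous bshift_continuous
    have : IsFiniteMeasure (M.map bshift) := Measure.isFiniteMeasure_map _ _
    have hreg' : (M.map bshift).Regular := inferInstance
    refine Measure.ext_of_integral_eq_on_compactlySupported fun f => ?_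
    rw [integral_map bshift_continuous.aemeasurable
      (map_continuous f).aestronglyMeasurable]
    have h1 := hintg (f.toContinuousMap.comp ⟨bshift, bshift_continuous⟩)
    have h2 := hintg f.toContinuousMap
    refine h1.trans (Eq.trans ?_ h2.symm)
    congr 1
    exact hE.shift1 (fun n => ((f (pure n) : ℝ) : ℂ)) (by
      obtain ⟨C, hC⟩ := hbd f.toContinuousMap
      exact ⟨C, fun n => by rw [Complex.norm_real]; exact hC n⟩)
  · intro g
    let gr : C(Ultrafilter ℕ, ℝ) := ⟨fun p => (g p).re, by fun_prop⟩
    let gi : C(Ultrafilter ℕ, ℝ) := ⟨fun p => (g p).im, by fun_prop⟩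
    have h1 := hintg gr
    have h2 := hintg gi
    have h3 : (fun n => g (pure n)) = fun n => ((gr (pure n) : ℝ) : ℂ) +
        Complex.I * ((gi (pure n) : ℝ) : ℂ) := by
      ext n; rw [mul_comm]; exact (Complex.re_add_im _).symm
    have h4 : ∀ p, g p = ((gr p : ℝ) : ℂ) + Complex.I * ((gi p : ℝ) : ℂ) := by
      intro p; rw [mul_comm]; exact (Complex.re_add_im _).symm
    rw [h3, IsMean.add_fun, IsMean.smul_fun, hE.real_eq (hbd gr), hE.real_eq (hbd gi), ← h1, ← h2]
    simp_rw [h4]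
    rw [integral_add (hcont gr).ofReal ((hcont gi).ofReal.const_mul _), integral_const_mul]
    rw [show ∫ a, ((gr a : ℝ) : ℂ) ∂M = ((∫ a, gr a ∂M : ℝ) : ℂ) from integral_ofReal,
      show ∫ a, ((gi a : ℝ) : ℂ) ∂M = ((∫ a, gi a ∂M : ℝ) : ℂ) from integral_ofReal]

open Filter MeasureTheory Topology

section kernels

/-- The Stone-Cech compactification of the naturals -/
abbrev Ωβ := Ultrafilter ℕ

/-- extension of the character `n ↦ z ^ n` -/
noncomputable def Zc (z : Circle) (p : Ωβ) : ℂ :=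
  ((Ultrafilter.extend (fun n : ℕ => z ^ n) p : Circle) : ℂ)

lemma Zc_continuous (z : Circle) : Continuous (Zc z) := by
  have h1 : Continuous (fun u : Circle => (u : ℂ)) := by fun_prop
  exact h1.comp (continuous_ultrafilter_extend _)

lemma Zc_pure (z : Circle) (n : ℕ) : Zc z (pure n) = (z : ℂ) ^ n := by
  unfold Zc
  have := congrFun (ultrafilter_extend_extends (fun n : ℕ => z ^ n)) n
  simp only [Function.comp] at this
  rw [this]; simp

lemma Zc_norm (z : Circle) (p : Ωβ) : ‖Zc z p‖ = 1 := Circle.norm_coe _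

lemma Zc_mul (z w : Circle) (p : Ωβ) : Zc (z * w) p = Zc z p * Zc w p := by
  have := DenseRange.equalizer denseRange_pure (Zc_continuous (z * w))
    ((Zc_continuous z).mul (Zc_continuous w)) (by
      ext n; simp [Zc_pure, mul_pow])
  exact congrFun this p

lemma Zc_one (p : Ωβ) : Zc 1 p = 1 := by
  have := DenseRange.equalizer denseRange_pure (Zc_continuous 1)
    (continuous_const (y := (1 : ℂ))) (by
      ext n; simp [Zc_pure])
  exact congrFun this p

lemma Zc_shift (z : Circle) (p : Ωβ) : Zc z (bshift p) = z * Zc z p := by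
  have := DenseRange.equalizer denseRange_pure ((Zc_continuous z).comp bshift_continuous)
    ((continuous_const (y := (z : ℂ))).mul (Zc_continuous z)) (by
      ext n; simp [Zc_pure, bshift_pure, pow_succ'])
  exact congrFun this p

lemma Zc_mul_conj (z : Circle) (p : Ωβ) : Zc z p * (starRingEnd ℂ) (Zc z p) = 1 := by
  rw [Complex.mul_conj, Complex.normSq_eq_norm_sq, Zc_norm]; simp

lemma Zc_inv (z : Circle) (p : Ωβ) : Zc z⁻¹ p = (starRingEnd ℂ) (Zc z p) := by
  have h1 : Zc z⁻¹ p * Zc z p = 1 := by rw [← Zc_mul, inv_mul_cancel, Zc_one]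
  have h2 := Zc_mul_conj z p
  calc _ = Zc z⁻¹ p * (Zc z p * (starRingEnd ℂ) (Zc z p)) := by rw [h2, mul_one]
    _ = _ := by rw [← mul_assoc, h1, one_mul]

lemma Zc_shift_iter (z : Circle) (k : ℕ) (p : Ωβ) :
    Zc z (bshift^[k] p) = (z : ℂ) ^ k * Zc z p := by
  induction k with
  | zero => simp
  | succ k ih => rw [Function.iterate_succ_apply', Zc_shift, ih, pow_succ']; ring

/-- positive-definite trigonometric kernels -/
def PosTrig (k : Ωβ → Ωβ → ℝ) : Prop :=
  ∃ (ι : Type) (_ : Fintype ι) (a : ι → ℝ) (z : ι → Circle), (∀ i, 0 ≤ a i) ∧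
    ∀ p' p, (k p' p : ℂ) = ∑ i, (a i : ℂ) * (Zc (z i) p' * (starRingEnd ℂ) (Zc (z i) p))

lemma PosTrig.const {c : ℝ} (hc : 0 ≤ c) : PosTrig (fun _ _ => c) :=
  ⟨Unit, inferInstance, fun _ => c, fun _ => 1, fun _ => hc, fun p' p => by simp [Zc_one]⟩

lemma PosTrig.add {k k' : Ωβ → Ωβ → ℝ} (h : PosTrig k) (h' : PosTrig k') :
    PosTrig (fun p' p => k p' p + k' p' p) := by
  obtain ⟨ι, _, a, z, ha, hk⟩ := h
  obtain ⟨ι', _, a', z', ha', hk'⟩ := h'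
  refine ⟨ι ⊕ ι', inferInstance, Sum.elim a a', Sum.elim z z', ?_, ?_⟩
  · rintro (i | i)
    · exact ha i
    · exact ha' i
  · intro p' p
    rw [Complex.ofReal_add, hk, hk', Fintype.sum_sum_type]
    simp

lemma PosTrig.mul {k k' : Ωβ → Ωβ → ℝ} (h : PosTrig k) (h' : PosTrig k') :
    PosTrig (fun p' p => k p' p * k' p' p) := by
  obtain ⟨ι, _, a, z, ha, hk⟩ := h
  obtain ⟨ι', _, a', z', ha', hk'⟩ := h'
  refine ⟨ι × ι', inferInstance, fun i => a i.1 * a' i.2, fun i => z i.1 * z' i.2, ?_, ?_⟩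
  · intro i
    exact mul_nonneg (ha _) (ha' _)
  · intro p' p
    rw [Complex.ofReal_mul, hk, hk', Fintype.sum_prod_type, Finset.sum_mul_sum]
    refine Finset.sum_congr rfl fun i _ => Finset.sum_congr rfl fun j _ => ?_
    simp only [Zc_mul, map_mul, Complex.ofReal_mul]
    ring

lemma PosTrig.sum {α : Type*} (s : Finset α) {k : α → Ωβ → Ωβ → ℝ} (h : ∀ i ∈ s, PosTrig (k i)) :
    PosTrig (fun p' p => ∑ i ∈ s, k i p' p) := by
  classical
  induction s using Finset.induction_on with
  | empty => simpa using PosTrig.const le_rfl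
  | insert a s ha ih =>
    simp only [Finset.sum_insert ha]
    exact (h a (by simp)).add (ih fun i hi => h i (by simp [hi]))

lemma PosTrig.pow {k : Ωβ → Ωβ → ℝ} (h : PosTrig k) (R : ℕ) :
    PosTrig (fun p' p => k p' p ^ R) := by
  induction R with
  | zero => simpa using PosTrig.const zero_le_one
  | succ R ih => simpa only [pow_succ] using ih.mul h

lemma PosTrig.gen (z : Circle) :
    PosTrig (fun p' p => 1 / 2 + (Zc z p' * (starRingEnd ℂ) (Zc z p)).re / 2) := by
  refine PosTrig.add (PosTrig.const (by norm_num)) ?_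
  refine ⟨Bool, inferInstance, fun _ => 1 / 4, fun b => if b then z else z⁻¹,
    fun _ => by norm_num, fun p' p => ?_⟩
  simp only [Fintype.sum_bool, if_true, Zc_inv, Complex.conj_conj, Bool.false_eq_true, if_false]
  set u := Zc z p' * (starRingEnd ℂ) (Zc z p) with hu
  have h1 : (starRingEnd ℂ) (Zc z p') * Zc z p = (starRingEnd ℂ) u := by simp [hu]
  rw [h1]
  apply Complex.ext <;> simp <;> ring

/-- the basic kernel -/
noncomputable def cv (s : Finset Circle) (p' p : Ωβ) : ℝ :=
  (s.card : ℝ)⁻¹ * ∑ z ∈ s, (1 / 2 + (Zc z p' * (starRingEnd ℂ) (Zc z p)).re / 2)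

lemma cv_posTrig (s : Finset Circle) : PosTrig (cv s) :=
  PosTrig.mul (PosTrig.const (by positivity)) (PosTrig.sum s fun z _ => PosTrig.gen z)

lemma re_abs_le (z : Circle) (p' p : Ωβ) :
    |(Zc z p' * (starRingEnd ℂ) (Zc z p)).re| ≤ 1 := by
  refine (Complex.abs_re_le_norm _).trans ?_
  rw [norm_mul, RCLike.norm_conj, Zc_norm, Zc_norm, one_mul]

lemma cv_nonneg (s : Finset Circle) (p' p : Ωβ) : 0 ≤ cv s p' p := by
  refine mul_nonneg (by positivity) (Finset.sum_nonneg fun z _ => ?_)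
  have := abs_le.mp (re_abs_le z p' p)
  linarith

lemma one_sub_cv (s : Finset Circle) (hs : s.Nonempty) (p' p : Ωβ) :
    4 * s.card * (1 - cv s p' p) = ∑ z ∈ s, ‖Zc z p' - Zc z p‖ ^ 2 := by
  have h1 : ∀ z : Circle, ‖Zc z p' - Zc z p‖ ^ 2 =
      2 - 2 * (Zc z p' * (starRingEnd ℂ) (Zc z p)).re := by
    intro z
    rw [← Complex.normSq_eq_norm_sq, Complex.normSq_sub, Complex.normSq_eq_norm_sq,
      Complex.normSq_eq_norm_sq, Zc_norm, Zc_norm]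
    ring
  have hc : (s.card : ℝ) ≠ 0 := by exact_mod_cast hs.card_pos.ne'
  simp_rw [h1]
  unfold cv
  rw [Finset.sum_sub_distrib, Finset.sum_add_distrib, ← Finset.mul_sum]
  rw [show (∑ z ∈ s, (Zc z p' * (starRingEnd ℂ) (Zc z p)).re / 2) =
    (∑ z ∈ s, (Zc z p' * (starRingEnd ℂ) (Zc z p)).re) / 2 from (Finset.sum_div _ _ _).symm]
  simp only [Finset.sum_const, nsmul_eq_mul]
  field_simp
  ring

lemma cv_le_one (s : Finset Circle) (hs : s.Nonempty) (p' p : Ωβ) : cv s p' p ≤ 1 := by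
  have h := one_sub_cv s hs p' p
  have hc : (0 : ℝ) < s.card := by exact_mod_cast hs.card_pos
  have h2 : 0 ≤ 4 * (s.card : ℝ) * (1 - cv s p' p) := by rw [h]; positivity
  have h3 : 0 ≤ 1 - cv s p' p := nonneg_of_mul_nonneg_right h2 (by positivity)
  linarith

lemma cv_self (s : Finset Circle) (hs : s.Nonempty) (p : Ωβ) : cv s p p = 1 := by
  have h := one_sub_cv s hs p p
  have hc : (0 : ℝ) < s.card := by exact_mod_cast hs.card_pos
  simp only [sub_self, norm_zero] at h
  norm_num at h
  rcases h with h | h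
  · simp [h] at hs
  · linarith

lemma cv_near (s : Finset Circle) (hs : s.Nonempty) (p' p : Ωβ) (z : Circle) (hz : z ∈ s) :
    ‖Zc z p' - Zc z p‖ ^ 2 ≤ 4 * s.card * (1 - cv s p' p) := by
  rw [one_sub_cv s hs]
  exact Finset.single_le_sum (f := fun z => ‖Zc z p' - Zc z p‖ ^ 2) (fun _ _ => by positivity) hz

lemma PosTrig.continuous_left {k : Ωβ → Ωβ → ℝ} (h : PosTrig k) (p : Ωβ) :
    Continuous (fun p' => k p' p) := by
  obtain ⟨ι, _, a, z, ha, hk⟩ := h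
  have h1 : (fun p' => k p' p) = fun p' => (k p' p : ℂ).re := by ext; simp
  rw [h1]
  simp_rw [hk]
  have := fun i => Zc_continuous (z i)
  fun_prop

lemma PosTrig.continuous_right {k : Ωβ → Ωβ → ℝ} (h : PosTrig k) (p' : Ωβ) :
    Continuous (fun p => k p' p) := by
  obtain ⟨ι, _, a, z, ha, hk⟩ := h
  have h1 : (fun p => k p' p) = fun p => (k p' p : ℂ).re := by ext; simp
  rw [h1]
  simp_rw [hk]
  have := fun i => Complex.continuous_conj.comp (Zc_continuous (z i))
  simp only [Function.comp_def] at this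
  fun_prop

lemma PosTrig.shift {k : Ωβ → Ωβ → ℝ} (h : PosTrig k) (t : ℕ) (p' p : Ωβ) :
    k (bshift^[t] p') (bshift^[t] p) = k p' p := by
  obtain ⟨ι, _, a, z, ha, hk⟩ := h
  have : (k (bshift^[t] p') (bshift^[t] p) : ℂ) = k p' p := by
    rw [hk, hk]
    refine Finset.sum_congr rfl fun i _ => ?_
    rw [Zc_shift_iter, Zc_shift_iter, map_mul]
    have h1 : ((z i : ℂ) ^ t) * (starRingEnd ℂ) ((z i : ℂ) ^ t) = 1 := by
      rw [Complex.mul_conj, Complex.normSq_eq_norm_sq, norm_pow, Circle.norm_coe]; simp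
    linear_combination (a i : ℂ) * (Zc (z i) p' * (starRingEnd ℂ) (Zc (z i) p)) * h1
  exact_mod_cast this

end kernels

open Filter MeasureTheory Topology

section kernelints
open scoped Classical

/-- the mass of a kernel -/
noncomputable def kap (M : Measure Ωβ) (k : Ωβ → Ωβ → ℝ) : ℝ := ∫ p, k p (pure 0) ∂M

/-- package of a mean and its measure -/
structure MeanMeas (E : (ℕ → ℂ) →ₗ[ℂ] ℂ) (M : Measure Ωβ) : Prop where
  mean : IsMean E
  prob : IsProbabilityMeasure M
  pres : MeasurePreserving bshift M M
  hintg : ∀ g : C(Ωβ, ℂ), ∫ p, g p ∂M = E (fun n => g (pure n))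

variable {E : (ℕ → ℂ) →ₗ[ℂ] ℂ} {M : Measure Ωβ}

lemma cont_integrable [IsFiniteMeasure M] {g : Ωβ → ℂ} (hg : Continuous g) : Integrable g M :=
  hg.integrable_of_hasCompactSupport (HasCompactSupport.of_compactSpace _)

lemma cont_integrable_real [IsFiniteMeasure M] {g : Ωβ → ℝ} (hg : Continuous g) :
    Integrable g M :=
  hg.integrable_of_hasCompactSupport (HasCompactSupport.of_compactSpace _)

lemma conjZ_mul_integrable (z : Circle) {F : Ωβ → ℂ} (hF : Integrable F M) :
    Integrable (fun p => (starRingEnd ℂ) (Zc z p) * F p) M := by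
  refine Integrable.bdd_mul (c := 1) hF
    (Complex.continuous_conj.comp (Zc_continuous z)).aestronglyMeasurable ?_
  refine Eventually.of_forall fun p => ?_
  show ‖(starRingEnd ℂ) (Zc z p)‖ ≤ 1
  rw [RCLike.norm_conj, Zc_norm]

lemma k_mul_integrable {k : Ωβ → Ωβ → ℝ} (h : PosTrig k) (p' : Ωβ) {F : Ωβ → ℂ}
    (hF : Integrable F M) : Integrable (fun p => (k p' p : ℂ) * F p) M := by
  have hc := h.continuous_right p'
  obtain ⟨C, hC⟩ := (isCompact_range hc).isBounded.exists_norm_le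
  refine Integrable.bdd_mul (c := C) hF (by fun_prop) ?_
  refine Eventually.of_forall fun p => ?_
  rw [Complex.norm_real]
  exact hC _ ⟨p, rfl⟩

lemma kint {k : Ωβ → Ωβ → ℝ} {ι : Type} [Fintype ι] {a : ι → ℝ} {z : ι → Circle}
    (hk : ∀ p' p, (k p' p : ℂ) =
      ∑ i, (a i : ℂ) * (Zc (z i) p' * (starRingEnd ℂ) (Zc (z i) p)))
    {F : Ωβ → ℂ} (hF : Integrable F M) (p' : Ωβ) :
    ∫ p, (k p' p : ℂ) * F p ∂M =
      ∑ i, (a i : ℂ) * (Zc (z i) p' * ∫ p, (starRingEnd ℂ) (Zc (z i) p) * F p ∂M) := by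
  simp_rw [hk, Finset.sum_mul]
  rw [integral_finsetSum]
  · refine Finset.sum_congr rfl fun i _ => ?_
    rw [← mul_assoc, ← integral_const_mul]
    congr 1; ext p; ring
  · intro i _
    have := (conjZ_mul_integrable (z i) hF).const_mul ((a i : ℂ) * Zc (z i) p')
    refine this.congr (Eventually.of_forall fun p => ?_)
    simp only; ring

lemma conjZ_int_le (z : Circle) (F : Ωβ → ℂ) :
    ‖∫ p, (starRingEnd ℂ) (Zc z p) * F p ∂M‖ ≤ ∫ p, ‖F p‖ ∂M := by
  refine (norm_integral_le_integral_norm _).trans (le_of_eq ?_)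
  congr 1; ext p
  rw [norm_mul, RCLike.norm_conj, Zc_norm, one_mul]

namespace MeanMeas
variable (hEM : MeanMeas E M)
include hEM

lemma int_Zc (z : Circle) : ∫ p, Zc z p ∂M = if z = 1 then 1 else 0 := by
  have h := hEM.hintg ⟨Zc z, Zc_continuous z⟩
  simp only [ContinuousMap.coe_mk, Zc_pure] at h
  rw [h]
  split_ifs with hz
  · simp only [hz, Circle.coe_one, one_pow]; exact hEM.mean.one
  · exact hEM.mean.char_zero (Circle.norm_coe z) (fun h => hz (by ext; simpa using h))

lemma E_pow (z : Circle) : E (fun n => (z : ℂ) ^ n) = if z = 1 then 1 else 0 := by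
  have h := hEM.hintg ⟨Zc z, Zc_continuous z⟩
  simp only [ContinuousMap.coe_mk, Zc_pure] at h
  rw [← h, hEM.int_Zc]

lemma kap_expand {k : Ωβ → Ωβ → ℝ} {ι : Type} [Fintype ι] {a : ι → ℝ} {z : ι → Circle}
    (hk : ∀ p' p, (k p' p : ℂ) =
      ∑ i, (a i : ℂ) * (Zc (z i) p' * (starRingEnd ℂ) (Zc (z i) p))) (p0 : Ωβ) :
    ((∫ p, k p p0 ∂M : ℝ) : ℂ) = ∑ i, if z i = 1 then (a i : ℂ) else 0 := by
  have := hEM.prob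
  rw [← integral_complex_ofReal]
  simp_rw [hk]
  rw [integral_finsetSum]
  · refine Finset.sum_congr rfl fun i _ => ?_
    rw [integral_const_mul, integral_mul_const, hEM.int_Zc]
    split_ifs with h
    · rw [h, Zc_one]; simp
    · simp
  · intro i _
    have := Zc_continuous (z i)
    exact cont_integrable (by fun_prop)

lemma kap_eq {k : Ωβ → Ωβ → ℝ} (h : PosTrig k) (p0 : Ωβ) : ∫ p, k p p0 ∂M = kap M k := by
  obtain ⟨ι, _, a, z, ha, hk⟩ := h
  have h1 := hEM.kap_expand hk p0
  have h2 := hEM.kap_expand hk (pure 0)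
  unfold kap
  exact_mod_cast h1.trans h2.symm

lemma bdd_kint {k : Ωβ → Ωβ → ℝ} (h : PosTrig k) {F : ℕ → Ωβ → ℂ} (hF : ∀ n, Integrable (F n) M)
    {C : ℝ} (hC : ∀ n, ∫ p, ‖F n p‖ ∂M ≤ C) (t : ℕ) :
    BddSeq (fun n => ∫ p, (k (pure (n + t)) p : ℂ) * F n p ∂M) := by
  obtain ⟨ι, _, a, z, ha, hk⟩ := h
  simp_rw [kint hk (hF _)]
  refine BddSeq.sum _ fun i _ => ⟨|a i| * C, fun n => ?_⟩
  rw [norm_mul, norm_mul, Zc_norm, one_mul, Complex.norm_real, Real.norm_eq_abs]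
  gcongr
  exact (conjZ_int_le _ _).trans (hC n)

lemma E_kint_const {k : Ωβ → Ωβ → ℝ} (h : PosTrig k) {F : Ωβ → ℂ} (hF : Integrable F M) :
    E (fun n => ∫ p, (k (pure n) p : ℂ) * F p ∂M) = (kap M k : ℂ) * ∫ p, F p ∂M := by
  obtain ⟨ι, _, a, z, ha, hk⟩ := h
  simp_rw [kint hk hF, Zc_pure]
  rw [IsMean.sum_fun]
  unfold kap
  rw [hEM.kap_expand hk, Finset.sum_mul]
  refine Finset.sum_congr rfl fun i _ => ?_
  rw [IsMean.smul_fun, IsMean.mul_const, hEM.E_pow]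
  split_ifs with h1
  · simp [h1, Zc_one]
  · simp

lemma E_kint_char {k : Ωβ → Ωβ → ℝ} (h : PosTrig k) (l m : ℕ) {F : ℕ → Ωβ → ℂ}
    (hF : ∀ n, Integrable (F n) M) {C : ℝ} (hC : ∀ n, ∫ p, ‖F n p‖ ∂M ≤ C)
    (hinv : ∀ n, F (n + l) =ᵐ[M] fun p => F n (bshift^[m] p)) :
    ∑ t ∈ Finset.range (l + m), E (fun n => ∫ p, (k (pure (n + t)) p : ℂ) * F n p ∂M) =
      ((l + m : ℕ) : ℂ) * (kap M k : ℂ) * E (fun n => ∫ p, F n p ∂M) := by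
  obtain ⟨ι, _, a, z, ha, hk⟩ := h
  have hpm : MeasurePreserving (bshift^[m]) M M := hEM.pres.iterate m
  let A : Circle → ℂ := fun z => E (fun n => (z : ℂ) ^ n *
    ∫ p, (starRingEnd ℂ) (Zc z p) * F n p ∂M)
  have hA : ∀ z, A z = (z : ℂ) ^ (l + m) * A z := by
    intro z
    have hb : BddSeq (fun n => (z : ℂ) ^ n * ∫ p, (starRingEnd ℂ) (Zc z p) * F n p ∂M) :=
      ⟨C, fun n => by
        rw [norm_mul, norm_pow, Circle.norm_coe, one_pow, one_mul]
        exact (conjZ_int_le _ _).trans (hC n)⟩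
    have h1 := hEM.mean.shift hb l
    have h2 : ∀ n, ∫ p, (starRingEnd ℂ) (Zc z p) * F (n + l) p ∂M =
        (z : ℂ) ^ m * ∫ p, (starRingEnd ℂ) (Zc z p) * F n p ∂M := by
      intro n
      have e1 : ∫ p, (starRingEnd ℂ) (Zc z p) * F n p ∂M =
          ∫ p, (starRingEnd ℂ) (Zc z (bshift^[m] p)) * F n (bshift^[m] p) ∂M := by
        conv_lhs => rw [← hpm.map_eq]
        rw [integral_map hpm.measurable.aemeasurable]
        rw [hpm.map_eq]
        exact (conjZ_mul_integrable z (hF n)).aestronglyMeasurable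
      rw [e1, ← integral_const_mul]
      refine integral_congr_ae ?_
      filter_upwards [hinv n] with p hp
      rw [hp, Zc_shift_iter, map_mul]
      have h1 : ((z : ℂ) ^ m) * (starRingEnd ℂ) ((z : ℂ) ^ m) = 1 := by
        rw [Complex.mul_conj, Complex.normSq_eq_norm_sq, norm_pow, Circle.norm_coe]; simp
      linear_combination -((starRingEnd ℂ) (Zc z p) * F n (bshift^[m] p)) * h1
    have h3 : (fun n => (z : ℂ) ^ (n + l) *
        ∫ p, (starRingEnd ℂ) (Zc z p) * F (n + l) p ∂M) = fun n => (z : ℂ) ^ (l + m) *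
        ((z : ℂ) ^ n * ∫ p, (starRingEnd ℂ) (Zc z p) * F n p ∂M) := by
      ext n; rw [h2, pow_add, pow_add]; ring
    rw [h3, IsMean.smul_fun] at h1
    exact h1.symm
  have hA1 : A 1 = E (fun n => ∫ p, F n p ∂M) := by
    simp only [A, Circle.coe_one, one_pow, one_mul, Zc_one, map_one]
  have hsum : ∀ z : Circle, ∑ t ∈ Finset.range (l + m), (z : ℂ) ^ t * A z =
      if z = 1 then ((l + m : ℕ) : ℂ) * A 1 else 0 := by
    intro z
    split_ifs with hz
    · subst hz; simp
    · rw [← Finset.sum_mul]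
      have hz1 : (z : ℂ) - 1 ≠ 0 := sub_ne_zero.mpr (fun h => hz (by ext; simpa using h))
      have h4 := geom_sum_mul (z : ℂ) (l + m)
      have h5 : ((z : ℂ) - 1) * ((∑ t ∈ Finset.range (l + m), (z : ℂ) ^ t) * A z) = 0 := by
        rw [← mul_assoc, mul_comm ((z : ℂ) - 1), h4, sub_mul, ← hA z]; ring
      exact (mul_eq_zero.mp h5).resolve_left hz1
  have h6 : ∀ t, E (fun n => ∫ p, (k (pure (n + t)) p : ℂ) * F n p ∂M) =
      ∑ i, (a i : ℂ) * ((z i : ℂ) ^ t * A (z i)) := by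
    intro t
    simp_rw [kint hk (hF _), Zc_pure]
    rw [IsMean.sum_fun]
    refine Finset.sum_congr rfl fun i _ => ?_
    rw [IsMean.smul_fun]
    congr 1
    simp only [A]
    rw [← IsMean.smul_fun]
    congr 1; ext n; rw [pow_add]; ring
  simp_rw [h6]
  rw [Finset.sum_comm]
  simp_rw [← Finset.mul_sum, hsum]
  rw [← hA1]
  unfold kap
  rw [hEM.kap_expand hk, Finset.mul_sum, Finset.sum_mul]
  refine Finset.sum_congr rfl fun i _ => ?_
  split_ifs <;> ring

lemma kint_continuous {k : Ωβ → Ωβ → ℝ} (h : PosTrig k) {F : Ωβ → ℂ} (hF : Integrable F M) :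
    Continuous (fun p' => ∫ p, (k p' p : ℂ) * F p ∂M) := by
  obtain ⟨ι, _, a, z, ha, hk⟩ := h
  simp_rw [kint hk hF]
  have := fun i => Zc_continuous (z i)
  fun_prop

lemma kap_quad {k : Ωβ → Ωβ → ℝ} (h : PosTrig k) {f : Ωβ → ℝ} (hf : Integrable f M) :
    kap M k * (∫ p, f p ∂M) ^ 2 ≤
      (∫ p', (f p' : ℂ) * ∫ p, (k p' p : ℂ) * (f p : ℂ) ∂M ∂M).re := by
  obtain ⟨ι, _, a, z, ha, hk⟩ := h
  have hF : Integrable (fun p => (f p : ℂ)) M := hf.ofReal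
  let c : ι → ℂ := fun i => ∫ p, (starRingEnd ℂ) (Zc (z i) p) * (f p : ℂ) ∂M
  have h1 : ∫ p', (f p' : ℂ) * ∫ p, (k p' p : ℂ) * (f p : ℂ) ∂M ∂M =
      ∑ i, (a i : ℂ) * ((starRingEnd ℂ) (c i) * c i) := by
    simp_rw [kint hk hF, Finset.mul_sum]
    rw [integral_finsetSum]
    · refine Finset.sum_congr rfl fun i _ => ?_
      have e1 : (starRingEnd ℂ) (c i) = ∫ p, (f p : ℂ) * Zc (z i) p ∂M := by
        simp only [c]
        rw [← integral_conj]
        congr 1; ext p; simp [mul_comm]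
      rw [e1, ← integral_mul_const, ← integral_const_mul]
      congr 1; ext p
      simp only [c]; ring
    · intro i _
      have h2 : Integrable (fun p => Zc (z i) p * (f p : ℂ)) M := by
        refine Integrable.bdd_mul (c := 1) hF (Zc_continuous _).aestronglyMeasurable
          (Eventually.of_forall fun p => (Zc_norm _ _).le)
      refine (h2.const_mul ((a i : ℂ) * c i)).congr (Eventually.of_forall fun p => ?_)
      simp only [c]; ring
  have h3 : kap M k = ∑ i, if z i = 1 then a i else 0 := by
    have := hEM.kap_expand hk (pure 0)
    unfold kap
    have h4 : (∑ i, if z i = 1 then (a i : ℂ) else 0) = ((∑ i, if z i = 1 then a i else 0 : ℝ) : ℂ) := by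
      push_cast
      refine Finset.sum_congr rfl fun i _ => ?_
      split_ifs <;> simp
    rw [h4] at this
    exact_mod_cast this
  rw [h1, h3, Complex.re_sum, Finset.sum_mul]
  refine Finset.sum_le_sum fun i _ => ?_
  rw [Complex.re_ofReal_mul, mul_comm ((starRingEnd ℂ) (c i)), Complex.mul_conj, Complex.ofReal_re]
  split_ifs with hz
  · refine le_of_eq ?_
    congr 1
    simp only [c, hz, Zc_one, map_one, one_mul]
    rw [integral_complex_ofReal, Complex.normSq_ofReal, sq]
  · rw [zero_mul]
    exact mul_nonneg (ha i) (Complex.normSq_nonneg _)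

lemma kap_nonneg {k : Ωβ → Ωβ → ℝ} (h : ∀ p' p, 0 ≤ k p' p) : 0 ≤ kap M k :=
  integral_nonneg fun p => h _ _

/-- concentration -/
lemma exists_R (s : Finset Circle) (hs : s.Nonempty) (e : ℝ) (he : 0 < e) (he1 : e < 1) :
    ∃ R : ℕ, 0 < kap M (fun p' p => cv s p' p ^ R) ∧
      (1 - e) * kap M (fun p' p => cv s p' p ^ R) ≤ kap M (fun p' p => cv s p' p ^ (R + 1)) := by
  have := hEM.prob
  -- a neighbourhood with positive measure
  obtain ⟨p0, hp0⟩ : ∃ p0, 0 < M {p | 1 - e / 2 < cv s p p0} := by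
    by_contra! hcon
    have hopen : ∀ p0, IsOpen {p | 1 - e / 2 < cv s p p0} := fun p0 =>
      isOpen_lt continuous_const ((cv_posTrig s).continuous_left p0)
    obtain ⟨t, ht⟩ := isCompact_univ.elim_finite_subcover (fun p0 => {p | 1 - e / 2 < cv s p p0})
      hopen (fun p _ => Set.mem_iUnion.mpr ⟨p, by
        rw [Set.mem_ofPred_eq, cv_self s hs]; linarith⟩)
    have h1 : M Set.univ ≤ 0 := by
      refine (measure_mono ht).trans ?_
      refine (measure_biUnion_finset_le _ _).trans ?_
      exact (Finset.sum_le_sum fun i _ => hcon i).trans (by simp)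
    rw [measure_univ] at h1
    simp at h1
  set U := {p | 1 - e / 2 < cv s p p0} with hU
  have hUm : MeasurableSet U :=
    (isOpen_lt continuous_const ((cv_posTrig s).continuous_left p0)).measurableSet
  set d := M.real U with hd
  have hdpos : 0 < d := ENNReal.toReal_pos hp0.ne' (measure_ne_top _ _)
  have hlow : ∀ R, d * (1 - e / 2) ^ R ≤ kap M (fun p' p => cv s p' p ^ R) := by
    intro R
    rw [← hEM.kap_eq ((cv_posTrig s).pow R) p0]
    have hc := ((cv_posTrig s).pow R).continuous_left p0
    have h1 : d * (1 - e / 2) ^ R = ∫ p, U.indicator (fun _ => (1 - e / 2) ^ R) p ∂M := by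
      rw [integral_indicator_const _ hUm, smul_eq_mul]
    rw [h1]
    refine integral_mono ((integrable_const _).indicator hUm) (cont_integrable_real hc) fun p => ?_
    by_cases hp : p ∈ U
    · rw [Set.indicator_of_mem hp]
      have : 1 - e / 2 < cv s p p0 := hp
      have h0 : 0 ≤ 1 - e / 2 := by linarith
      simp only
      gcongr
    · rw [Set.indicator_of_notMem hp]
      exact pow_nonneg (cv_nonneg _ _ _) _
  have hpos : ∀ R, 0 < kap M (fun p' p => cv s p' p ^ R) := fun R =>
    lt_of_lt_of_le (mul_pos hdpos (pow_pos (by linarith) R)) (hlow R)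
  by_contra! hcon
  have hup : ∀ R, kap M (fun p' p => cv s p' p ^ R) ≤ (1 - e) ^ R := by
    intro R
    induction R with
    | zero => simp [kap]
    | succ R ih =>
      refine (hcon R (hpos R)).le.trans ?_
      rw [pow_succ, mul_comm ((1 - e) ^ R)]
      gcongr
  have hr : Tendsto (fun R : ℕ => ((1 - e) / (1 - e / 2)) ^ R) atTop (𝓝 0) := by
    apply tendsto_pow_atTop_nhds_zero_of_lt_one
    · apply div_nonneg <;> linarith
    · rw [div_lt_one] <;> linarith
  obtain ⟨R, hR⟩ := (hr.eventually (gt_mem_nhds hdpos)).exists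
  rw [div_pow, div_lt_iff₀ (pow_pos (by linarith) R)] at hR
  linarith [hlow R, hup R]

end MeanMeas
end kernelints

open Filter MeasureTheory Topology

section vdec
open scoped Classical
variable {E : (ℕ → ℂ) →ₗ[ℂ] ℂ} {M : Measure Ωβ}

lemma l1_le_l2 [IsProbabilityMeasure M] (f : Lp ℂ 2 M) : ∫ p, ‖f p‖ ∂M ≤ ‖f‖ := by
  have h1 : Integrable f M := (Lp.memLp f).integrable (by norm_num)
  rw [integral_norm_eq_lintegral_enorm h1.aestronglyMeasurable, Lp.norm_def]
  refine ENNReal.toReal_mono (Lp.eLpNorm_ne_top f) ?_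
  rw [← eLpNorm_one_eq_lintegral_enorm]
  exact eLpNorm_le_eLpNorm_of_exponent_le (by norm_num) h1.aestronglyMeasurable

lemma MeanMeas.vdecomp (hEM : MeanMeas E M) (l m : ℕ) (hl : 0 < l) (v : ℕ → Ωβ → ℝ)
    (hvc : ∀ n, Continuous (v n)) (hv : ∀ n p, v (n + l) p = v n (bshift^[m] p))
    (η : ℝ) (hη : 0 < η) :
    ∃ (s : Finset Circle) (h : Circle → Ωβ → ℂ) (r w : ℕ → Ωβ → ℂ), s.Nonempty ∧
      (∀ z, Measurable (h z)) ∧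
      (∀ z, Integrable (h z) M) ∧ (∀ n, Integrable (r n) M) ∧ (∀ n, Integrable (w n) M) ∧
      (∀ n, (fun p => (v n p : ℂ)) =ᵐ[M]
        fun p => (∑ z ∈ s, (z : ℂ) ^ n * h z p) + r n p + w n p) ∧
      (∀ n, r (n + l) =ᵐ[M] fun p => r n (bshift^[m] p)) ∧ (∀ n, ∫ p, ‖r n p‖ ∂M ≤ η) ∧
      (∃ C, ∀ n, ∫ p, ‖w n p‖ ∂M ≤ C) ∧
      ∀ φ : Ωβ → ℂ, AEStronglyMeasurable φ M → (∀ p, ‖φ p‖ ≤ 1) →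
        E (fun n => ((‖∫ p, φ p * w n p ∂M‖ ^ 2 : ℝ) : ℂ)) = 0 := by
  have := hEM.prob
  have hpm : MeasurePreserving (bshift^[m]) M M := hEM.pres.iterate m
  let V : Lp ℂ 2 M →ₗᵢ[ℂ] Lp ℂ 2 M := Lp.compMeasurePreservingₗᵢ ℂ (bshift^[m]) hpm
  have hV : ∀ f : Lp ℂ 2 M, V f =ᵐ[M] fun p => f (bshift^[m] p) := fun f =>
    Lp.coeFn_compMeasurePreserving f hpm
  have hmem : ∀ n, MemLp (fun p => (v n p : ℂ)) 2 M := by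
    intro n
    have hc : Continuous (fun p => (v n p : ℂ)) := by have := hvc n; fun_prop
    exact hc.memLp_of_hasCompactSupport (HasCompactSupport.of_compactSpace _)
  obtain ⟨s, h, r, w, h1, h2, h3, ⟨C, h4⟩, h5⟩ := decomp hEM.mean V (fun n => (hmem n).toLp _) l hl
    (by
      intro n
      refine Lp.ext ?_
      refine (MemLp.coeFn_toLp _).trans ?_
      refine EventuallyEq.trans ?_ (hV _).symm
      have h6 := hpm.quasiMeasurePreserving.ae_eq_comp (MemLp.coeFn_toLp (hmem n))
      refine EventuallyEq.trans ?_ h6.symm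
      refine Eventually.of_forall fun p => ?_
      simp [hv]) η hη
  let h' : Circle → Lp ℂ 2 M := fun z => if z ∈ s then h z else 0
  refine ⟨insert 1 s, fun z => h' z, fun n => r n, fun n => w n, Finset.insert_nonempty _ _,
    fun z => (Lp.stronglyMeasurable _).measurable,
    fun z => (Lp.memLp _).integrable (by norm_num), fun z => (Lp.memLp _).integrable (by norm_num),
    fun z => (Lp.memLp _).integrable (by norm_num), ?_, ?_, ?_, ?_, ?_⟩
  · intro n
    have e1 : ∑ z ∈ s, ((z : ℂ) ^ n) • h z = ∑ z ∈ insert 1 s, ((z : ℂ) ^ n) • h' z := by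
      have : ∑ z ∈ s, ((z : ℂ) ^ n) • h z = ∑ z ∈ s, ((z : ℂ) ^ n) • h' z :=
        Finset.sum_congr rfl fun z hz => by simp only [h', if_pos hz]
      rw [this]
      refine Finset.sum_subset (Finset.subset_insert _ _) fun z _ hz => ?_
      simp only [h', if_neg hz, smul_zero]
    have e2 := h1 n
    rw [e1] at e2
    have e3 : (∑ z ∈ insert 1 s, ((z : ℂ) ^ n) • h' z : Lp ℂ 2 M) =ᵐ[M]
        fun p => ∑ z ∈ insert 1 s, (z : ℂ) ^ n * h' z p := by
      have e4 := Lp.coeFn_finsetSum (insert 1 s) (fun z : Circle => ((z : ℂ) ^ n) • h' z)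
      have e5 : ∀ᵐ p ∂M, ∀ z ∈ insert 1 s, ((((z : ℂ) ^ n) • h' z : Lp ℂ 2 M) : Ωβ → ℂ) p =
          (z : ℂ) ^ n * h' z p := by
        rw [Finset.eventually_all]
        intro z _
        filter_upwards [Lp.coeFn_smul ((z : ℂ) ^ n) (h' z)] with p hp
        rw [hp]; rfl
      filter_upwards [e4, e5] with p hp hp2
      rw [hp, Finset.sum_apply]
      exact Finset.sum_congr rfl fun z hz => hp2 z hz
    have e6 := MemLp.coeFn_toLp (hmem n)
    rw [e2] at e6
    refine e6.symm.trans ?_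
    filter_upwards [Lp.coeFn_add (∑ z ∈ insert 1 s, ((z : ℂ) ^ n) • h' z + r n) (w n),
      Lp.coeFn_add (∑ z ∈ insert 1 s, ((z : ℂ) ^ n) • h' z) (r n), e3] with p p1 p2 p3
    rw [p1, Pi.add_apply, p2, Pi.add_apply, p3]
  · intro n
    show (r (n + l) : Ωβ → ℂ) =ᵐ[M] fun p => (r n : Ωβ → ℂ) (bshift^[m] p)
    rw [h2 n]; exact hV _
  · intro n
    exact (l1_le_l2 _).trans (h3 n)
  · exact ⟨C, fun n => (l1_le_l2 _).trans (h4 n)⟩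
  · intro φ hφ hφ1
    have hm : MemLp (fun p => (starRingEnd ℂ) (φ p)) 2 M := by
      refine MemLp.of_bound (C := 1) (Complex.continuous_conj.comp_aestronglyMeasurable hφ) ?_
      refine Eventually.of_forall fun p => ?_
      rw [RCLike.norm_conj]; exact hφ1 p
    rw [← h5 (hm.toLp _)]
    congr 1; ext n; congr 3
    rw [L2.inner_def]
    refine integral_congr_ae ?_
    filter_upwards [hm.coeFn_toLp] with p hp
    rw [hp]; simp [mul_comm]

end vdec

open Filter MeasureTheory Topology

section compare
open scoped Classical
variable {E : (ℕ → ℂ) →ₗ[ℂ] ℂ} {M : Measure Ωβ}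

lemma k_mul_integrable_real {k : Ωβ → Ωβ → ℝ} (h : PosTrig k) (p' : Ωβ) {F : Ωβ → ℝ}
    (hF : Integrable F M) : Integrable (fun p => k p' p * F p) M := by
  have h1 := (k_mul_integrable (F := fun p => (F p : ℂ)) h p' hF.ofReal).re
  refine h1.congr (Eventually.of_forall fun p => ?_)
  simp [← Complex.ofReal_mul]

lemma kint_ofReal (k : Ωβ → Ωβ → ℝ) (p' : Ωβ) (F : Ωβ → ℝ) :
    ((∫ p, k p' p * F p ∂M : ℝ) : ℂ) = ∫ p, (k p' p : ℂ) * (F p : ℂ) ∂M := by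
  rw [← integral_complex_ofReal]; simp

namespace MeanMeas
variable (hEM : MeanMeas E M)
include hEM

lemma bdd_kint_real {k : Ωβ → Ωβ → ℝ} (h : PosTrig k) {F : ℕ → Ωβ → ℝ}
    (hF : ∀ n, Integrable (F n) M) {C : ℝ} (hC : ∀ n, ∫ p, ‖F n p‖ ∂M ≤ C) (t : ℕ) :
    ∃ D, ∀ n, |∫ p, k (pure (n + t)) p * F n p ∂M| ≤ D := by
  obtain ⟨D, hD⟩ := hEM.bdd_kint h (F := fun n p => (F n p : ℂ)) (fun n => (hF n).ofReal)
    (C := C) (fun n => by simpa using hC n) t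
  refine ⟨D, fun n => ?_⟩
  have := hD n
  beta_reduce at this
  rwa [← kint_ofReal, Complex.norm_real] at this

lemma E_kint_const_real {k : Ωβ → Ωβ → ℝ} (h : PosTrig k) {F : Ωβ → ℝ} (hF : Integrable F M) :
    E (fun n => ((∫ p, k (pure n) p * F p ∂M : ℝ) : ℂ)) = ((kap M k * ∫ p, F p ∂M : ℝ) : ℂ) := by
  simp_rw [kint_ofReal]
  rw [hEM.E_kint_const (F := fun p => (F p : ℂ)) h hF.ofReal, Complex.ofReal_mul, integral_complex_ofReal]

lemma r_bound {k : Ωβ → Ωβ → ℝ} (h : PosTrig k) (hk0 : ∀ p' p, 0 ≤ k p' p) (l m : ℕ) (hl : 0 < l)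
    {r : ℕ → Ωβ → ℂ} (hr : ∀ n, Integrable (r n) M) {η : ℝ} (hη : ∀ n, ∫ p, ‖r n p‖ ∂M ≤ η)
    (hinv : ∀ n, r (n + l) =ᵐ[M] fun p => r n (bshift^[m] p)) :
    (E (fun n => ((∫ p, k (pure n) p * ‖r n p‖ ∂M : ℝ) : ℂ))).re ≤ (l + m : ℕ) * kap M k * η := by
  have h1 := hEM.E_kint_char h l m (F := fun n p => ((‖r n p‖ : ℝ) : ℂ))
    (fun n => (hr n).norm.ofReal) (C := η) (fun n => by simpa using hη n) (fun n => by
      filter_upwards [hinv n] with p hp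
      rw [hp])
  simp_rw [← kint_ofReal] at h1
  have h2 := congrArg Complex.re h1
  rw [Complex.re_sum] at h2
  have hbd := fun t => hEM.bdd_kint_real h (F := fun n p => ‖r n p‖) (fun n => (hr n).norm) (C := η)
    (fun n => by simpa using hη n) t
  have h3 : ∀ t, 0 ≤ (E (fun n => ((∫ p, k (pure (n + t)) p * ‖r n p‖ ∂M : ℝ) : ℂ))).re := by
    intro t
    obtain ⟨D, hD⟩ := hbd t
    exact (hEM.mean.nonneg ⟨D, fun n => (le_abs_self _).trans (hD n)⟩
      (fun n => integral_nonneg fun p => mul_nonneg (hk0 _ _) (norm_nonneg _))).1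
  have h4 := Finset.single_le_sum (s := Finset.range (l + m)) (f := fun t =>
    (E (fun n => ((∫ p, k (pure (n + t)) p * ‖r n p‖ ∂M : ℝ) : ℂ))).re) (fun t _ => h3 t)
    (Finset.mem_range.mpr (show 0 < l + m by omega))
  simp only [add_zero] at h4
  refine h4.trans ?_
  rw [h2]
  have h5 : ((l + m : ℕ) : ℂ) * (kap M k : ℂ) = (((l + m : ℕ) * kap M k : ℝ) : ℂ) := by push_cast; ring
  rw [h5, Complex.re_ofReal_mul]
  refine mul_le_mul_of_nonneg_left ?_ (mul_nonneg (by positivity) (hEM.kap_nonneg hk0))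
  refine (Complex.re_le_norm _).trans (hEM.mean.norm_le fun n => ?_)
  rw [integral_complex_ofReal, Complex.norm_real, Real.norm_of_nonneg (integral_nonneg fun p => norm_nonneg _)]
  exact hη n

lemma w_zero {k : Ωβ → Ωβ → ℝ} (h : PosTrig k) {w : ℕ → Ωβ → ℂ} (hw : ∀ n, Integrable (w n) M)
    {C : ℝ} (hC : ∀ n, ∫ p, ‖w n p‖ ∂M ≤ C)
    (hw0 : ∀ φ : Ωβ → ℂ, AEStronglyMeasurable φ M → (∀ p, ‖φ p‖ ≤ 1) →
        E (fun n => ((‖∫ p, φ p * w n p ∂M‖ ^ 2 : ℝ) : ℂ)) = 0)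
    (a : ℕ → ℂ) (ha : ∀ n, ‖a n‖ ≤ 1) (f : Ωβ → ℂ) (hf : Measurable f) (hf1 : ∀ p, ‖f p‖ ≤ 1) :
    E (fun n => a n * ∫ p, (k (pure n) p : ℂ) * (f p * w n p) ∂M) = 0 := by
  obtain ⟨ι, _, c, z, hc, hk⟩ := h
  have hfw : ∀ n, Integrable (fun p => f p * w n p) M := fun n =>
    Integrable.bdd_mul (c := 1) (hw n) hf.aestronglyMeasurable (Eventually.of_forall hf1)
  simp_rw [kint hk (hfw _), Zc_pure, Finset.mul_sum]
  rw [IsMean.sum_fun]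
  refine Finset.sum_eq_zero fun i _ => ?_
  have e1 : ∀ n, a n * ((c i : ℂ) * ((z i : ℂ) ^ n * ∫ p, (starRingEnd ℂ) (Zc (z i) p) * (f p * w n p) ∂M))
      = (a n * ((c i : ℂ) * (z i : ℂ) ^ n)) * ∫ p, ((starRingEnd ℂ) (Zc (z i) p) * f p) * w n p ∂M := by
    intro n
    simp_rw [mul_assoc]
  simp_rw [e1]
  have hφ1 : ∀ p, ‖(starRingEnd ℂ) (Zc (z i) p) * f p‖ ≤ 1 := fun p => by
    rw [norm_mul, RCLike.norm_conj, Zc_norm, one_mul]; exact hf1 p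
  refine hEM.mean.zero_mul_of_sq ⟨C, fun n => ?_⟩ ⟨|c i|, fun n => ?_⟩ (hw0 _ ?_ hφ1)
  · refine (norm_integral_le_integral_norm _).trans ((integral_mono_of_nonneg
      (Eventually.of_forall fun p => norm_nonneg _) (hw n).norm
      (Eventually.of_forall fun p => ?_)).trans (hC n))
    simp only
    rw [norm_mul]
    exact mul_le_of_le_one_left (norm_nonneg _) (hφ1 p)
  · rw [norm_mul, norm_mul, norm_pow, Circle.norm_coe, one_pow, mul_one, Complex.norm_real,
      Real.norm_eq_abs]
    exact mul_le_of_le_one_left (abs_nonneg _) (ha n)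
  · exact ((Complex.continuous_conj.comp (Zc_continuous _)).measurable.mul hf).aestronglyMeasurable

lemma kcompare (l m : ℕ) (hl : 0 < l) (v : ℕ → Ωβ → ℝ) (hvi : ∀ n, Integrable (v n) M)
    {s : Finset Circle} (hs : s.Nonempty) {h : Circle → Ωβ → ℂ} {r w : ℕ → Ωβ → ℂ}
    (hh : ∀ z, Integrable (h z) M) (hr : ∀ n, Integrable (r n) M) (hw : ∀ n, Integrable (w n) M)
    (hdec : ∀ n, (fun p => (v n p : ℂ)) =ᵐ[M]
        fun p => (∑ z ∈ s, (z : ℂ) ^ n * h z p) + r n p + w n p)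
    (hrinv : ∀ n, r (n + l) =ᵐ[M] fun p => r n (bshift^[m] p)) {η : ℝ}
    (hη : ∀ n, ∫ p, ‖r n p‖ ∂M ≤ η)
    {C : ℝ} (hC : ∀ n, ∫ p, ‖w n p‖ ∂M ≤ C)
    (hw0 : ∀ φ : Ωβ → ℂ, AEStronglyMeasurable φ M → (∀ p, ‖φ p‖ ≤ 1) →
        E (fun n => ((‖∫ p, φ p * w n p ∂M‖ ^ 2 : ℝ) : ℂ)) = 0)
    (R : ℕ) (s0 : ℝ) (hs0 : 0 < s0)
    (a : ℕ → ℝ) (ha : ∀ n, 0 ≤ a n ∧ a n ≤ 1) (f : Ωβ → ℝ) (hf : Measurable f)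
    (hf1 : ∀ p, 0 ≤ f p ∧ f p ≤ 1) :
    ‖E (fun n => (a n : ℂ) * ∫ p, ((cv s (pure n) p ^ R : ℝ) : ℂ) * ((f p : ℂ) * (v n p : ℂ)) ∂M) -
      E (fun n => (a n : ℂ) * ∫ p, ((cv s (pure n) p ^ R : ℝ) : ℂ) *
        ((f p : ℂ) * ∑ z ∈ s, Zc z p * h z p) ∂M)‖ ≤
    (l + m : ℕ) * kap M (fun p' p => cv s p' p ^ R) * η +
      (∑ z ∈ s, ∫ p, ‖h z p‖ ∂M) * (s0 * kap M (fun p' p => cv s p' p ^ R) + 4 * s.card / s0 *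
        (kap M (fun p' p => cv s p' p ^ R) - kap M (fun p' p => cv s p' p ^ (R + 1)))) := by
  set k : Ωβ → Ωβ → ℝ := fun p' p => cv s p' p ^ R with hk
  set k1 : Ωβ → Ωβ → ℝ := fun p' p => cv s p' p ^ (R + 1) with hk1
  have hkT : PosTrig k := (cv_posTrig s).pow R
  have hk1T : PosTrig k1 := (cv_posTrig s).pow (R + 1)
  have hk0 : ∀ p' p, 0 ≤ k p' p := fun _ _ => pow_nonneg (cv_nonneg _ _ _) _
  have hfn : ∀ p, ‖(f p : ℂ)‖ ≤ 1 := fun p => by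
    rw [Complex.norm_real, Real.norm_of_nonneg (hf1 p).1]; exact (hf1 p).2
  have hfm : Measurable (fun p => (f p : ℂ)) := by fun_prop
  have hfi : ∀ {F : Ωβ → ℂ}, Integrable F M → Integrable (fun p => (f p : ℂ) * F p) M := fun hF =>
    Integrable.bdd_mul (c := 1) hF hfm.aestronglyMeasurable (Eventually.of_forall hfn)
  have hZi : ∀ z, Integrable (fun p => Zc z p * h z p) M := fun z =>
    Integrable.bdd_mul (c := 1) (hh z) (Zc_continuous _).aestronglyMeasurable
          (Eventually.of_forall fun p => (Zc_norm _ _).le)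
  have hei : Integrable (fun p => ∑ z ∈ s, Zc z p * h z p) M := integrable_finsetSum _ fun z _ => hZi z
  let D : ℕ → Ωβ → ℂ := fun n p => (∑ z ∈ s, ((z : ℂ) ^ n - Zc z p) * h z p) + r n p
  have hDi : ∀ n, Integrable (D n) M := by
    intro n
    refine Integrable.add (integrable_finsetSum _ fun z _ => ?_) (hr n)
    refine (((hh z).const_mul ((z : ℂ) ^ n)).sub (hZi z)).congr (Eventually.of_forall fun p => ?_)
    simp only [Pi.sub_apply]; ring
  have hvC : ∀ n, Integrable (fun p => (v n p : ℂ)) M := fun n => (hvi n).ofReal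
  have hsplit : ∀ n, (a n : ℂ) * ∫ p, (k (pure n) p : ℂ) * ((f p : ℂ) * (v n p : ℂ)) ∂M -
      (a n : ℂ) * ∫ p, (k (pure n) p : ℂ) * ((f p : ℂ) * ∑ z ∈ s, Zc z p * h z p) ∂M =
      (a n : ℂ) * ∫ p, (k (pure n) p : ℂ) * ((f p : ℂ) * w n p) ∂M +
      (a n : ℂ) * ∫ p, (k (pure n) p : ℂ) * ((f p : ℂ) * D n p) ∂M := by
    intro n
    rw [← mul_sub, ← mul_add, ← integral_sub (k_mul_integrable hkT _ (hfi (hvC n)))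
      (k_mul_integrable hkT _ (hfi hei)), ← integral_add (k_mul_integrable hkT _ (hfi (hw n)))
      (k_mul_integrable hkT _ (hfi (hDi n)))]
    congr 1
    refine integral_congr_ae ?_
    filter_upwards [hdec n] with p hp
    simp only [D]
    rw [hp]
    simp_rw [sub_mul]
    rw [Finset.sum_sub_distrib]
    ring
  rw [← IsMean.sub_fun]
  change ‖E (fun n => (a n : ℂ) * ∫ p, (k (pure n) p : ℂ) * ((f p : ℂ) * (v n p : ℂ)) ∂M -
      (a n : ℂ) * ∫ p, (k (pure n) p : ℂ) * ((f p : ℂ) * ∑ z ∈ s, Zc z p * h z p) ∂M)‖ ≤ _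
  simp_rw [hsplit]
  rw [IsMean.add_fun, hEM.w_zero hkT hw hC hw0 (fun n => (a n : ℂ)) (fun n => by
    rw [Complex.norm_real, Real.norm_of_nonneg (ha n).1]; exact (ha n).2) _ hfm hfn, zero_add]
  let I : Circle → ℕ → ℝ := fun z n => ∫ p, k (pure n) p * ‖h z p‖ ∂M
  let I1 : Circle → ℕ → ℝ := fun z n => ∫ p, k1 (pure n) p * ‖h z p‖ ∂M
  let J : ℕ → ℝ := fun n => ∫ p, k (pure n) p * ‖r n p‖ ∂M
  let X : ℕ → ℝ := fun n => (∑ z ∈ s, ((s0 + 4 * s.card / s0) * I z n - 4 * s.card / s0 * I1 z n)) + J n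
  have hkI : ∀ {F : Ωβ → ℝ} n, Integrable F M → Integrable (fun p => k (pure n) p * F p) M :=
    fun n hF => k_mul_integrable_real hkT _ hF
  have hk1I : ∀ {F : Ωβ → ℝ} n, Integrable F M → Integrable (fun p => k1 (pure n) p * F p) M :=
    fun n hF => k_mul_integrable_real hk1T _ hF
  have hle : ∀ n, ‖(a n : ℂ) * ∫ p, (k (pure n) p : ℂ) * ((f p : ℂ) * D n p) ∂M‖ ≤ X n := by
    intro n
    have hint1 : ∀ z, Integrable (fun p => (s0 + 4 * s.card / s0) * (k (pure n) p * ‖h z p‖) -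
        4 * s.card / s0 * (k1 (pure n) p * ‖h z p‖)) M := fun z =>
      ((hkI n (hh z).norm).const_mul _).sub ((hk1I n (hh z).norm).const_mul _)
    have hX : X n = ∫ p, ((∑ z ∈ s, ((s0 + 4 * s.card / s0) * (k (pure n) p * ‖h z p‖) -
        4 * s.card / s0 * (k1 (pure n) p * ‖h z p‖))) + k (pure n) p * ‖r n p‖) ∂M := by
      rw [integral_add (integrable_finsetSum _ fun z _ => hint1 z) (hkI n (hr n).norm),
        integral_finsetSum _ (fun z _ => hint1 z)]
      simp only [X]
      congr 1
      refine Finset.sum_congr rfl fun z _ => ?_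
      rw [integral_sub ((hkI n (hh z).norm).const_mul _) ((hk1I n (hh z).norm).const_mul _),
        integral_const_mul, integral_const_mul]
    rw [norm_mul, Complex.norm_real, Real.norm_of_nonneg (ha n).1]
    refine (mul_le_of_le_one_left (norm_nonneg _) (ha n).2).trans ?_
    rw [hX]
    refine (norm_integral_le_integral_norm _).trans (integral_mono_of_nonneg
      (Eventually.of_forall fun p => norm_nonneg _)
      (Integrable.add (integrable_finsetSum _ fun z _ =>
        ((hkI n (hh z).norm).const_mul _).sub ((hk1I n (hh z).norm).const_mul _)) (hkI n (hr n).norm))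
      (Eventually.of_forall fun p => ?_))
    simp only
    rw [norm_mul, norm_mul, Complex.norm_real, Real.norm_of_nonneg (hk0 _ _)]
    have h1 : ‖(f p : ℂ)‖ * ‖D n p‖ ≤ ‖D n p‖ := mul_le_of_le_one_left (norm_nonneg _) (hfn p)
    have h2 : ‖D n p‖ ≤ (∑ z ∈ s, ‖(z : ℂ) ^ n - Zc z p‖ * ‖h z p‖) + ‖r n p‖ := by
      refine (norm_add_le _ _).trans (add_le_add_left ?_ _)
      refine (norm_sum_le _ _).trans (Finset.sum_le_sum fun z _ => by rw [norm_mul])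
    have h3 : ∀ z ∈ s, ‖(z : ℂ) ^ n - Zc z p‖ ≤ s0 + 4 * s.card / s0 * (1 - cv s (pure n) p) := by
      intro z hz
      have e1 := cv_near s hs (pure n) p z hz
      rw [Zc_pure] at e1
      set x := ‖(z : ℂ) ^ n - Zc z p‖
      have e2 : x ≤ s0 + x ^ 2 / s0 := by
        rw [← sub_nonneg]
        have : s0 + x ^ 2 / s0 - x = ((s0 - x / 2) ^ 2 + 3 / 4 * x ^ 2) / s0 := by field_simp; ring
        rw [this]; positivity
      have e3 : x ^ 2 / s0 ≤ 4 * s.card / s0 * (1 - cv s (pure n) p) := by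
        rw [div_mul_eq_mul_div]; gcongr
      linarith
    calc k (pure n) p * (‖(f p : ℂ)‖ * ‖D n p‖) ≤
        k (pure n) p * ((∑ z ∈ s, (s0 + 4 * s.card / s0 * (1 - cv s (pure n) p)) * ‖h z p‖) + ‖r n p‖) := by
          refine mul_le_mul_of_nonneg_left (h1.trans (h2.trans (add_le_add_left ?_ _))) (hk0 _ _)
          exact Finset.sum_le_sum fun z hz => mul_le_mul_of_nonneg_right (h3 z hz) (norm_nonneg _)
      _ = _ := by
          rw [mul_add, Finset.mul_sum]
          congr 1
          refine Finset.sum_congr rfl fun z _ => ?_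
          simp only [hk, hk1, pow_succ]; ring
  have hIb : ∀ z, ∃ B, ∀ n, |I z n| ≤ B := fun z => hEM.bdd_kint_real hkT (F := fun _ p => ‖h z p‖)
    (fun _ => (hh z).norm) (fun _ => le_rfl) 0
  have hI1b : ∀ z, ∃ B, ∀ n, |I1 z n| ≤ B := fun z => hEM.bdd_kint_real hk1T (F := fun _ p => ‖h z p‖)
    (fun _ => (hh z).norm) (fun _ => le_rfl) 0
  have hJb : ∃ B, ∀ n, |J n| ≤ B := hEM.bdd_kint_real hkT (F := fun n p => ‖r n p‖)
    (fun n => (hr n).norm) (C := η) (fun n => by simpa using hη n) 0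
  have hXb : ∃ B, ∀ n, X n ≤ B := by
    choose B1 hB1 using hIb
    choose B2 hB2 using hI1b
    obtain ⟨B3, hB3⟩ := hJb
    refine ⟨(∑ z ∈ s, ((s0 + 4 * s.card / s0) * B1 z + 4 * s.card / s0 * B2 z)) + B3, fun n => ?_⟩
    refine add_le_add (Finset.sum_le_sum fun z _ => ?_) ((le_abs_self _).trans (hB3 n))
    have e1 := (le_abs_self _).trans (hB1 z n)
    have e2 := (neg_le_abs _).trans (hB2 z n)
    have e3 := mul_le_mul_of_nonneg_left e1 (show 0 ≤ s0 + 4 * s.card / s0 by positivity)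
    have e4 := mul_le_mul_of_nonneg_left e2 (show 0 ≤ 4 * s.card / s0 by positivity)
    linarith
  refine (hEM.mean.mono _ X hXb hle).trans ?_
  have hEX : E (fun n => (X n : ℂ)) = (((∑ z ∈ s, ∫ p, ‖h z p‖ ∂M) * (s0 * kap M k + 4 * s.card / s0 *
        (kap M k - kap M k1)) : ℝ) : ℂ) + E (fun n => (J n : ℂ)) := by
    have e1 : (fun n => (X n : ℂ)) = fun n => (∑ z ∈ s, (((s0 + 4 * s.card / s0 : ℝ) : ℂ) * (I z n : ℂ) -
        ((4 * s.card / s0 : ℝ) : ℂ) * (I1 z n : ℂ))) + (J n : ℂ) := by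
      ext n; simp only [X]; push_cast; rfl
    rw [e1, IsMean.add_fun, IsMean.sum_fun]
    congr 1
    rw [Finset.sum_mul, Complex.ofReal_sum]
    refine Finset.sum_congr rfl fun z _ => ?_
    rw [IsMean.sub_fun, IsMean.smul_fun, IsMean.smul_fun,
      hEM.E_kint_const_real hkT (hh z).norm, hEM.E_kint_const_real hk1T (hh z).norm]
    push_cast; ring
  rw [hEX, Complex.add_re, Complex.ofReal_re, add_comm]
  exact add_le_add_left (hEM.r_bound hkT hk0 l m hl hr hη hrinv) _

end MeanMeas
end compare

open Filter MeasureTheory Topology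

section endgame
open scoped Classical
variable {E : (ℕ → ℂ) →ₗ[ℂ] ℂ} {M : Measure Ωβ}

/-- real mean -/
noncomputable def ER (E : (ℕ → ℂ) →ₗ[ℂ] ℂ) (x : ℕ → ℝ) : ℝ := (E (fun n => (x n : ℂ))).re

/-- bounded real sequences -/
def RB (x : ℕ → ℝ) : Prop := ∃ C, ∀ n, |x n| ≤ C

lemma RB.add {x y : ℕ → ℝ} (hx : RB x) (hy : RB y) : RB (fun n => x n + y n) := by
  obtain ⟨C, hC⟩ := hx
  obtain ⟨D, hD⟩ := hy
  exact ⟨C + D, fun n => (abs_add_le _ _).trans (add_le_add (hC n) (hD n))⟩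

lemma RB.mul01 {x a : ℕ → ℝ} (hx : RB x) (ha : ∀ n, 0 ≤ a n ∧ a n ≤ 1) : RB (fun n => a n * x n) := by
  obtain ⟨C, hC⟩ := hx
  refine ⟨C, fun n => ?_⟩
  rw [abs_mul, abs_of_nonneg (ha n).1]
  exact (mul_le_of_le_one_left (abs_nonneg _) (ha n).2).trans (hC n)

lemma ER_add (x y : ℕ → ℝ) : ER E (fun n => x n + y n) = ER E x + ER E y := by
  unfold ER
  simp only [Complex.ofReal_add]
  rw [IsMean.add_fun, Complex.add_re]

lemma ER_sub (x y : ℕ → ℝ) : ER E (fun n => x n - y n) = ER E x - ER E y := by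
  unfold ER
  simp only [Complex.ofReal_sub]
  rw [IsMean.sub_fun, Complex.sub_re]

lemma IsMean.ER_mono (hE : IsMean E) {x y : ℕ → ℝ} (hx : RB x) (hy : RB y) (h : ∀ n, x n ≤ y n) :
    ER E x ≤ ER E y := hE.le_of_le hx hy h

lemma IsMean.re_E (hE : IsMean E) {f : ℕ → ℂ} (hf : BddSeq f) :
    (E f).re = ER E (fun n => (f n).re) := by
  obtain ⟨C, hC⟩ := hf
  have h1 : f = fun n => ((f n).re : ℂ) + Complex.I * ((f n).im : ℂ) := by
    ext n; rw [mul_comm]; simp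
  have h2 := hE.real_im (g := fun n => (f n).im) ⟨C, fun n => (Complex.abs_im_le_norm _).trans (hC n)⟩
  conv_lhs => rw [h1]
  rw [IsMean.add_fun, IsMean.smul_fun, Complex.add_re, Complex.I_mul_re, h2]
  simp [ER]

lemma IsMean.ER_tail (hE : IsMean E) {x : ℕ → ℝ} (hx : RB x) (W : ℕ) (h : ∀ n ≥ W, x n = 0) :
    ER E x = 0 := by
  obtain ⟨C, hC⟩ := hx
  unfold ER
  rw [hE.congr_tail (f := fun n => (x n : ℂ)) (g := fun _ => 0) ⟨C, fun n => by
    rw [Complex.norm_real]; exact hC n⟩ (BddSeq.const 0) W (fun n hn => by simp [h n hn]), hE.const]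
  simp

namespace MeanMeas
variable (hEM : MeanMeas E M)
include hEM

lemma ER_const {k : Ωβ → Ωβ → ℝ} (h : PosTrig k) {F : Ωβ → ℝ} (hF : Integrable F M) :
    ER E (fun n => ∫ p, k (pure n) p * F p ∂M) = kap M k * ∫ p, F p ∂M := by
  unfold ER
  rw [hEM.E_kint_const_real h hF, Complex.ofReal_re]

lemma RB_kint {k : Ωβ → Ωβ → ℝ} (h : PosTrig k) {F : ℕ → Ωβ → ℝ}
    (hF : ∀ n, Integrable (F n) M) {C : ℝ} (hC : ∀ n p, |F n p| ≤ C) :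
    RB (fun n => ∫ p, k (pure n) p * F n p ∂M) := by
  have := hEM.prob
  refine hEM.bdd_kint_real h hF (C := C) (fun n => ?_) 0
  refine (integral_mono (hF n).norm (integrable_const C) (fun p => hC n p)).trans (by simp)

lemma RB_kint_const {k : Ωβ → Ωβ → ℝ} (h : PosTrig k) {F : Ωβ → ℝ}
    (hF : Integrable F M) : RB (fun n => ∫ p, k (pure n) p * F p ∂M) :=
  hEM.bdd_kint_real h (F := fun _ => F) (fun _ => hF) (fun _ => le_rfl) 0

lemma v_kint {k : Ωβ → Ωβ → ℝ} (h : PosTrig k) (l m : ℕ) (v g : ℕ → Ωβ → ℝ)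
    (hgc : ∀ n, Continuous (g n)) {C : ℝ} (hgC : ∀ n p, |g n p| ≤ C)
    (hginv : ∀ n p, g (n + l) p = g n (bshift^[m] p))
    (hvg : ∀ n p, v n p = ∑ t ∈ Finset.range (l + m), g n (bshift^[t] p))
    {δ : ℝ} (hδ : ∀ n, ∫ p, g n p ∂M = δ) :
    ER E (fun n => ∫ p, k (pure n) p * v n p ∂M) = (l + m : ℕ) * kap M k * δ := by
  have := hEM.prob
  have hgi : ∀ n, Integrable (g n) M := fun n => cont_integrable_real (hgc n)
  have h1 := hEM.E_kint_char h l m (F := fun n p => ((g n p : ℝ) : ℂ))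
    (fun n => (hgi n).ofReal) (C := C) (fun n =>
      (integral_mono (hgi n).ofReal.norm (integrable_const C) (fun p => by
        simpa using hgC n p)).trans (by simp)) (fun n => by
      refine Eventually.of_forall fun p => ?_
      simp only [hginv])
  have hpure : ∀ t n, bshift^[t] (pure n) = pure (n + t) := by
    intro t n
    induction t with
    | zero => rfl
    | succ t ih => rw [Function.iterate_succ_apply', ih]; rfl
  have hsc : ∀ t, Continuous (bshift^[t]) := fun t => bshift_continuous.iterate t
  have h2 : ∀ n, ((∫ p, k (pure n) p * v n p ∂M : ℝ) : ℂ) =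
      ∑ t ∈ Finset.range (l + m), ∫ p, (k (pure (n + t)) p : ℂ) * (g n p : ℂ) ∂M := by
    intro n
    simp_rw [hvg, Finset.mul_sum]
    have hit : ∀ t, Integrable (fun p => k (pure n) p * g n (bshift^[t] p)) M := fun t =>
      k_mul_integrable_real h _ (cont_integrable_real ((hgc n).comp (hsc t)))
    rw [integral_finsetSum _ fun t _ => hit t, Complex.ofReal_sum]
    refine Finset.sum_congr rfl fun t _ => ?_
    rw [← kint_ofReal]
    congr 1
    have hpm : MeasurePreserving (bshift^[t]) M M := hEM.pres.iterate t
    conv_rhs => rw [← hpm.map_eq]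
    rw [integral_map hpm.measurable.aemeasurable]
    · congr 1; ext p
      rw [← hpure t n, h.shift]
    · rw [hpm.map_eq]
      exact (k_mul_integrable_real h _ (hgi n)).aestronglyMeasurable
  unfold ER
  simp_rw [h2]
  rw [IsMean.sum_fun, h1]
  simp_rw [integral_complex_ofReal, hδ]
  rw [hEM.mean.const]
  norm_cast

end MeanMeas
end endgame

open Filter MeasureTheory Topology

section endgame2
open scoped Classical
variable {E : (ℕ → ℂ) →ₗ[ℂ] ℂ} {M : Measure Ωβ}

lemma MeanMeas.endgame (hEM : MeanMeas E M) {k : Ωβ → Ωβ → ℝ} (hk : PosTrig k)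
    (hk0 : ∀ p' p, 0 ≤ k p' p) (hkap : 0 < kap M k) {Q : ℝ} (hQ : 0 < Q)
    (v : ℕ → Ωβ → ℝ) (hvc : ∀ n, Continuous (v n)) (hv0 : ∀ n p, 0 ≤ v n p) (hvQ : ∀ n p, v n p ≤ Q)
    (e : Ωβ → ℝ) (hem : Measurable e) (hei : Integrable e M) {σ : ℝ} (hσ : 0 ≤ σ)
    (hcomp : ∀ (a : ℕ → ℝ), (∀ n, 0 ≤ a n ∧ a n ≤ 1) → ∀ (f : Ωβ → ℝ), Measurable f →
      (∀ p, 0 ≤ f p ∧ f p ≤ 1) →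
      |ER E (fun n => a n * ∫ p, k (pure n) p * (f p * v n p) ∂M) -
        ER E (fun n => a n * ∫ p, k (pure n) p * (f p * e p) ∂M)| ≤ kap M k * σ)
    {γ : ℝ} (hγ : 2 * kap M k * γ ≤ ER E (fun n => ∫ p, k (pure n) p * v n p ∂M))
    (G : Set Ωβ) (hG : MeasurableSet G) (hGc : Q * M.real Gᶜ ≤ γ)
    {ι : Type} [Fintype ι] (pat : Ωβ → ι) (hpat : ∀ u, IsClopen (pat ⁻¹' {u})) (W : ℕ)
    (hbad : ∀ p ∈ G, ∀ n ≥ W, pat (pure n) = pat p → v n p = 0) :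
    γ - 3 * σ ≤ Fintype.card ι * √(3 * Q * σ) := by
  have := hEM.prob
  have hE := hEM.mean
  set κ := kap M k with hκ
  have hvi : ∀ n, Integrable (v n) M := fun n => cont_integrable_real (hvc n)
  -- indicator helper
  have ind01 : ∀ (S : Set Ωβ) p, 0 ≤ S.indicator (fun _ => (1 : ℝ)) p ∧
      S.indicator (fun _ => (1 : ℝ)) p ≤ 1 := by
    intro S p
    by_cases hp : p ∈ S <;> simp [hp]
  have indm : ∀ {S : Set Ωβ}, MeasurableSet S → Measurable (S.indicator (fun _ => (1 : ℝ))) :=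
    fun hS => measurable_const.indicator hS
  have fint : ∀ {f F : Ωβ → ℝ}, Measurable f → (∀ p, 0 ≤ f p ∧ f p ≤ 1) → Integrable F M →
      Integrable (fun p => f p * F p) M := fun hf hf1 hF =>
    Integrable.bdd_mul (c := 1) hF hf.aestronglyMeasurable (Eventually.of_forall fun p => by
      rw [Real.norm_of_nonneg (hf1 p).1]; exact (hf1 p).2)
  have fvb : ∀ {f : Ωβ → ℝ}, (∀ p, 0 ≤ f p ∧ f p ≤ 1) → ∀ n p, |f p * v n p| ≤ Q := by
    intro f hf1 n p
    rw [abs_of_nonneg (mul_nonneg (hf1 p).1 (hv0 n p))]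
    exact (mul_le_of_le_one_left (hv0 n p) (hf1 p).2).trans (hvQ n p)
  have RBfv : ∀ {f : Ωβ → ℝ}, Measurable f → (∀ p, 0 ≤ f p ∧ f p ≤ 1) →
      RB (fun n => ∫ p, k (pure n) p * (f p * v n p) ∂M) := fun hf hf1 =>
    hEM.RB_kint hk (fun n => fint hf hf1 (hvi n)) (fvb hf1)
  have fvle : ∀ {f : Ωβ → ℝ}, Measurable f → (∀ p, 0 ≤ f p ∧ f p ≤ 1) →
      ER E (fun n => ∫ p, k (pure n) p * (f p * v n p) ∂M) ≤ κ * (Q * ∫ p, f p ∂M) := by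
    intro f hf hf1
    have hfi : Integrable f M := by simpa using fint hf hf1 (integrable_const (1 : ℝ))
    rw [← integral_const_mul, ← hEM.ER_const hk (hfi.const_mul Q)]
    refine hE.ER_mono (RBfv hf hf1) (hEM.RB_kint_const hk (hfi.const_mul Q)) fun n => ?_
    refine integral_mono (k_mul_integrable_real hk _ (fint hf hf1 (hvi n)))
      (k_mul_integrable_real hk _ (hfi.const_mul Q)) fun p => ?_
    refine mul_le_mul_of_nonneg_left ?_ (hk0 _ _)
    rw [mul_comm Q]
    exact mul_le_mul_of_nonneg_left (hvQ n p) (hf1 p).1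
  have fvge : ∀ {f : Ωβ → ℝ}, Measurable f → (∀ p, 0 ≤ f p ∧ f p ≤ 1) →
      0 ≤ ER E (fun n => ∫ p, k (pure n) p * (f p * v n p) ∂M) := by
    intro f hf hf1
    have h0 : ER E (fun _ => (0 : ℝ)) = 0 := hE.ER_tail ⟨0, by simp⟩ 0 (by simp)
    rw [← h0]
    refine hE.ER_mono ⟨0, by simp⟩ (RBfv hf hf1) fun n => ?_
    exact integral_nonneg fun p => mul_nonneg (hk0 _ _) (mul_nonneg (hf1 p).1 (hv0 n p))
  have comp1 : ∀ {f : Ωβ → ℝ}, Measurable f → (∀ p, 0 ≤ f p ∧ f p ≤ 1) →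
      |ER E (fun n => ∫ p, k (pure n) p * (f p * v n p) ∂M) - κ * ∫ p, f p * e p ∂M| ≤ κ * σ := by
    intro f hf hf1
    have h1 := hcomp (fun _ => 1) (by simp) f hf hf1
    simp only [one_mul] at h1
    rwa [hEM.ER_const hk (fint hf hf1 hei)] at h1
  -- clamp
  let c : Ωβ → ℝ := fun p => max 0 (min Q (e p))
  have hcm : Measurable c := measurable_const.max (measurable_const.min hem)
  have hc0 : ∀ p, 0 ≤ c p := fun p => le_max_left _ _
  have hcQ : ∀ p, c p ≤ Q := fun p => max_le hQ.le (min_le_left _ _)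
  have hci : Integrable c M := by
    refine Integrable.mono' (integrable_const Q) hcm.aestronglyMeasurable
      (Eventually.of_forall fun p => ?_)
    rw [Real.norm_of_nonneg (hc0 p)]; exact hcQ p
  have hdi : Integrable (fun p => |c p - e p|) M := (hci.sub hei).abs
  have hd : ∫ p, |c p - e p| ∂M ≤ 2 * σ := by
    let S1 : Set Ωβ := {p | e p < 0}
    let S2 : Set Ωβ := {p | Q < e p}
    have hS1 : MeasurableSet S1 := measurableSet_lt hem measurable_const
    have hS2 : MeasurableSet S2 := measurableSet_lt measurable_const hem
    have a1 := comp1 (indm hS1) (ind01 S1)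
    have a2 := comp1 (indm hS2) (ind01 S2)
    have b1 := fvge (indm hS1) (ind01 S1)
    have b2 := fvle (indm hS2) (ind01 S2)
    have i1 := fint (indm hS1) (ind01 S1) hei
    have i2 := fint (indm hS2) (ind01 S2) hei
    have i3 : Integrable (S2.indicator (fun _ => (1 : ℝ))) M := (integrable_const _).indicator hS2
    have c1 : -σ ≤ ∫ p, S1.indicator (fun _ => (1 : ℝ)) p * e p ∂M := by
      have := (abs_le.mp a1).2
      refine le_of_mul_le_mul_left ?_ hkap
      linarith
    have c2 : (∫ p, S2.indicator (fun _ => (1 : ℝ)) p * e p ∂M) -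
        Q * ∫ p, S2.indicator (fun _ => (1 : ℝ)) p ∂M ≤ σ := by
      have := (abs_le.mp a2).1
      refine le_of_mul_le_mul_left ?_ hkap
      linarith
    have c3 : ∀ p, |c p - e p| = (S2.indicator (fun _ => (1 : ℝ)) p * e p -
        Q * S2.indicator (fun _ => (1 : ℝ)) p) - S1.indicator (fun _ => (1 : ℝ)) p * e p := by
      intro p
      simp only [c]
      rcases lt_or_ge (e p) 0 with h1 | h1
      · have m1 : p ∈ S1 := h1
        have m2 : p ∉ S2 := fun h => by have h' : Q < e p := h; linarith
        rw [Set.indicator_of_mem m1, Set.indicator_of_notMem m2, min_eq_right (by linarith),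
          max_eq_left h1.le, zero_sub, abs_neg, abs_of_neg h1]
        ring
      · have m1 : p ∉ S1 := fun h => by have h' : e p < 0 := h; linarith
        rw [Set.indicator_of_notMem m1]
        rcases lt_or_ge Q (e p) with h2 | h2
        · have m2 : p ∈ S2 := h2
          rw [Set.indicator_of_mem m2, min_eq_left h2.le, max_eq_right hQ.le, abs_of_neg (by linarith)]
          ring
        · have m2 : p ∉ S2 := fun h => by have h' : Q < e p := h; linarith
          rw [Set.indicator_of_notMem m2, min_eq_right h2, max_eq_right h1]
          simp
    have i4 : Integrable (fun p => S2.indicator (fun _ => (1 : ℝ)) p * e p -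
        Q * S2.indicator (fun _ => (1 : ℝ)) p) M := i2.sub (i3.const_mul Q)
    simp_rw [c3]
    rw [integral_sub i4 i1, integral_sub i2 (i3.const_mul Q), integral_const_mul]
    linarith
  -- the good set
  have hGe : γ - 3 * σ ≤ ∫ p, G.indicator (fun _ => (1 : ℝ)) p * c p ∂M := by
    have a1 := comp1 (indm hG) (ind01 G)
    have b1 := fvle (indm hG.compl) (ind01 Gᶜ)
    rw [integral_indicator_const _ hG.compl, smul_eq_mul, mul_one] at b1
    have h1 : ER E (fun n => ∫ p, k (pure n) p * v n p ∂M) =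
        ER E (fun n => ∫ p, k (pure n) p * (G.indicator (fun _ => (1 : ℝ)) p * v n p) ∂M) +
        ER E (fun n => ∫ p, k (pure n) p * (Gᶜ.indicator (fun _ => (1 : ℝ)) p * v n p) ∂M) := by
      rw [← ER_add]
      congr 1; ext n
      rw [← integral_add (k_mul_integrable_real hk _ (fint (indm hG) (ind01 G) (hvi n)))
        (k_mul_integrable_real hk _ (fint (indm hG.compl) (ind01 Gᶜ) (hvi n)))]
      congr 1; ext p
      by_cases hp : p ∈ G <;> simp [hp]
    have b2 : κ * (Q * M.real Gᶜ) ≤ κ * γ := mul_le_mul_of_nonneg_left hGc hkap.le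
    have a2 : γ - σ ≤ ∫ p, G.indicator (fun _ => (1 : ℝ)) p * e p ∂M := by
      have := (abs_le.mp a1).2
      refine le_of_mul_le_mul_left ?_ hkap
      linarith
    have a3 : (∫ p, G.indicator (fun _ => (1 : ℝ)) p * e p ∂M) - ∫ p, |c p - e p| ∂M ≤
        ∫ p, G.indicator (fun _ => (1 : ℝ)) p * c p ∂M := by
      rw [← integral_sub (fint (indm hG) (ind01 G) hei) hdi]
      refine integral_mono ((fint (indm hG) (ind01 G) hei).sub hdi)
        (fint (indm hG) (ind01 G) hci) fun p => ?_
      simp only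
      by_cases hp : p ∈ G
      · simp only [Set.indicator_of_mem hp, one_mul]
        linarith [neg_abs_le (c p - e p)]
      · simp only [Set.indicator_of_notMem hp, zero_mul, zero_sub]
        linarith [abs_nonneg (c p - e p)]
    linarith
  -- each pattern
  let S : ι → Set Ωβ := fun u => pat ⁻¹' {u} ∩ G
  have hSm : ∀ u, MeasurableSet (S u) := fun u => (hpat u).isOpen.measurableSet.inter hG
  have hU : ∀ u, ∫ p, (S u).indicator (fun _ => (1 : ℝ)) p * c p ∂M ≤ √(3 * Q * σ) := by
    intro u
    set f := (S u).indicator (fun _ => (1 : ℝ)) with hfdef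
    have hfm : Measurable f := indm (hSm u)
    have hf1 := ind01 (S u)
    let a : ℕ → ℝ := fun n => (pat ⁻¹' {u}).indicator (fun _ => (1 : ℝ)) (pure n)
    have ha : ∀ n, 0 ≤ a n ∧ a n ≤ 1 := fun n => ind01 _ _
    have h1 := hcomp a ha f hfm hf1
    have h2 : ER E (fun n => a n * ∫ p, k (pure n) p * (f p * v n p) ∂M) = 0 := by
      refine hE.ER_tail ((RBfv hfm hf1).mul01 ha) W fun n hn => ?_
      by_cases hp : (pure n : Ωβ) ∈ pat ⁻¹' {u}
      · have h3 : ∀ p, k (pure n) p * (f p * v n p) = 0 := by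
          intro p
          by_cases hpS : p ∈ S u
          · have e1 : pat p = u := hpS.1
            have e2 : pat (pure n) = u := hp
            rw [hbad p hpS.2 n hn (e2.trans e1.symm)]; ring
          · simp [hfdef, Set.indicator_of_notMem hpS]
        simp [h3]
      · simp only [a]
        rw [Set.indicator_of_notMem hp, zero_mul]
    rw [h2, zero_sub, abs_neg] at h1
    have h3 := (le_abs_self _).trans h1
    have hfe := fint hfm hf1 hei
    have hfc := fint hfm hf1 hci
    have h4 : ER E (fun n => a n * ∫ p, k (pure n) p * (f p * c p) ∂M) ≤ κ * (3 * σ) := by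
      have h5 : ER E (fun n => a n * ∫ p, k (pure n) p * (f p * c p) ∂M) ≤
          ER E (fun n => a n * (∫ p, k (pure n) p * (f p * e p) ∂M) +
            ∫ p, k (pure n) p * |c p - e p| ∂M) := by
        refine hE.ER_mono ((hEM.RB_kint_const hk hfc).mul01 ha)
          (((hEM.RB_kint_const hk hfe).mul01 ha).add (hEM.RB_kint_const hk hdi)) fun n => ?_
        have i1 := k_mul_integrable_real hk (pure n) hfc
        have i2 := k_mul_integrable_real hk (pure n) hfe
        have i3 := k_mul_integrable_real hk (pure n) hdi
        have h6 : ∫ p, k (pure n) p * (f p * c p) ∂M ≤ (∫ p, k (pure n) p * (f p * e p) ∂M) +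
            ∫ p, k (pure n) p * |c p - e p| ∂M := by
          rw [← integral_add i2 i3]
          refine integral_mono i1 (i2.add i3) fun p => ?_
          simp only
          rw [← mul_add]
          refine mul_le_mul_of_nonneg_left ?_ (hk0 _ _)
          have h7 : f p * (c p - e p) ≤ |c p - e p| := by
            refine (le_abs_self _).trans ?_
            rw [abs_mul, abs_of_nonneg (hf1 p).1]
            exact mul_le_of_le_one_left (abs_nonneg _) (hf1 p).2
          linarith
        have h8 : 0 ≤ ∫ p, k (pure n) p * |c p - e p| ∂M :=
          integral_nonneg fun p => mul_nonneg (hk0 _ _) (abs_nonneg _)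
        have h9 := mul_le_mul_of_nonneg_left h6 (ha n).1
        have h10 := mul_le_of_le_one_left h8 (ha n).2
        linarith
      rw [ER_add, hEM.ER_const hk hdi] at h5
      have h6 := mul_le_mul_of_nonneg_left hd hkap.le
      linarith
    -- lower bound
    let F : Ωβ → ℝ := fun p => f p * c p
    have hF0 : ∀ p, 0 ≤ F p := fun p => mul_nonneg (hf1 p).1 (hc0 p)
    let Φ : Ωβ → ℝ := fun p' => ∫ p, k p' p * F p ∂M
    have hΦ0 : ∀ p', 0 ≤ Φ p' := fun p' => integral_nonneg fun p => mul_nonneg (hk0 _ _) (hF0 p)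
    have hΦC : ∀ p', ((Φ p' : ℝ) : ℂ) = ∫ p, (k p' p : ℂ) * (F p : ℂ) ∂M := fun p' =>
      kint_ofReal k p' F
    have hΦc : Continuous Φ := by
      have h5 := hEM.kint_continuous hk (F := fun p => (F p : ℂ)) hfc.ofReal
      simp_rw [← hΦC] at h5
      have h6 := Complex.continuous_re.comp h5
      exact h6
    let Ψ : Ωβ → ℝ := fun p' => (pat ⁻¹' {u}).indicator (fun _ => (1 : ℝ)) p' * Φ p'
    have hΨc : Continuous Ψ := by
      refine Continuous.mul ?_ hΦc
      exact Continuous.indicator (by simp [(hpat u).frontier_eq]) continuous_const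
    have h5 : ER E (fun n => a n * ∫ p, k (pure n) p * (f p * c p) ∂M) = ∫ p, Ψ p ∂M := by
      have h6 := hEM.hintg ⟨fun p => (Ψ p : ℂ), by fun_prop⟩
      simp only [ContinuousMap.coe_mk] at h6
      rw [integral_complex_ofReal] at h6
      have h7 := congrArg Complex.re h6
      rw [Complex.ofReal_re] at h7
      exact h7.symm
    have hq := hEM.kap_quad hk hfc
    have h6 : (∫ p', ((f p' * c p' : ℝ) : ℂ) * ∫ p, (k p' p : ℂ) * ((f p * c p : ℝ) : ℂ) ∂M ∂M).re =
        ∫ p', F p' * Φ p' ∂M := by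
      have h7 : ∀ p', ((f p' * c p' : ℝ) : ℂ) * ∫ p, (k p' p : ℂ) * ((f p * c p : ℝ) : ℂ) ∂M =
          ((F p' * Φ p' : ℝ) : ℂ) := by
        intro p'
        rw [Complex.ofReal_mul (F p'), hΦC]
      simp_rw [h7]
      rw [integral_complex_ofReal, Complex.ofReal_re]
    rw [h6] at hq
    obtain ⟨B, hB⟩ := (isCompact_range hΦc).isBounded.exists_norm_le
    have hFΦ : Integrable (fun p => F p * Φ p) M := by
      have := Integrable.bdd_mul (c := B) hfc hΦc.aestronglyMeasurable
        (Eventually.of_forall fun p => hB _ ⟨p, rfl⟩)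
      exact this.congr (Eventually.of_forall fun p => mul_comm _ _)
    have h7 : ∫ p', F p' * Φ p' ∂M ≤ Q * ∫ p, Ψ p ∂M := by
      rw [← integral_const_mul]
      refine integral_mono hFΦ ((cont_integrable_real hΨc).const_mul Q) fun p => ?_
      simp only [Ψ, F, hfdef]
      by_cases hp : p ∈ S u
      · rw [Set.indicator_of_mem hp, Set.indicator_of_mem hp.1, one_mul, one_mul]
        exact mul_le_mul_of_nonneg_right (hcQ p) (hΦ0 p)
      · rw [Set.indicator_of_notMem hp, zero_mul, zero_mul]
        exact mul_nonneg hQ.le (mul_nonneg (ind01 _ _).1 (hΦ0 p))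
    refine Real.le_sqrt_of_sq_le ?_
    refine le_of_mul_le_mul_left ?_ hkap
    refine hq.trans (h7.trans ?_)
    rw [← h5]
    have := mul_le_mul_of_nonneg_left h4 hQ.le
    linarith
  -- sum up
  have hsum : ∫ p, G.indicator (fun _ => (1 : ℝ)) p * c p ∂M =
      ∑ u, ∫ p, (S u).indicator (fun _ => (1 : ℝ)) p * c p ∂M := by
    rw [← integral_finsetSum _ fun u _ => fint (indm (hSm u)) (ind01 _) hci]
    congr 1; ext p
    rw [← Finset.sum_mul]
    congr 1
    rw [Finset.sum_eq_single (pat p)]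
    · by_cases hp : p ∈ G
      · rw [Set.indicator_of_mem hp, Set.indicator_of_mem]
        exact ⟨rfl, hp⟩
      · rw [Set.indicator_of_notMem hp, Set.indicator_of_notMem]
        exact fun h => hp h.2
    · intro u _ hu
      exact Set.indicator_of_notMem (fun h => hu (Eq.symm h.1)) _
    · simp
  rw [hsum] at hGe
  refine hGe.trans ((Finset.sum_le_card_nsmul _ _ _ fun u _ => hU u).trans ?_)
  simp

end endgame2

open Filter MeasureTheory Topology

section mainabs
open scoped Classical
variable {E : (ℕ → ℂ) →ₗ[ℂ] ℂ} {M : Measure Ωβ}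

lemma MeanMeas.main_abs (hEM : MeanMeas E M) (l m : ℕ) (hl : 0 < l) {Q : ℝ} (hQ : 0 < Q)
    (v g : ℕ → Ωβ → ℝ) (hvc : ∀ n, Continuous (v n)) (hv0 : ∀ n p, 0 ≤ v n p)
    (hvQ : ∀ n p, v n p ≤ Q) (hvinv : ∀ n p, v (n + l) p = v n (bshift^[m] p))
    (hgc : ∀ n, Continuous (g n)) {C : ℝ} (hgC : ∀ n p, |g n p| ≤ C)
    (hginv : ∀ n p, g (n + l) p = g n (bshift^[m] p))
    (hvg : ∀ n p, v n p = ∑ t ∈ Finset.range (l + m), g n (bshift^[t] p))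
    {δ : ℝ} (hδ : ∀ n, ∫ p, g n p ∂M = δ) (hδ0 : 0 < δ)
    (G : Set Ωβ) (hG : MeasurableSet G) (hGc : Q * M.real Gᶜ ≤ (l + m : ℕ) * δ / 2)
    {ι : Type} [Fintype ι] (pat : Ωβ → ι) (hpat : ∀ u, IsClopen (pat ⁻¹' {u})) (W : ℕ)
    (hbad : ∀ p ∈ G, ∀ n ≥ W, pat (pure n) = pat p → v n p = 0) : False := by
  have := hEM.prob
  set q : ℝ := ((l + m : ℕ) : ℝ) with hq
  have hq0 : 0 < q := by rw [hq]; exact_mod_cast (by omega : 0 < l + m)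
  set γ := q * δ / 2 with hγ
  have hγ0 : 0 < γ := by positivity
  obtain ⟨σ, hσ0, hσ⟩ : ∃ σ : ℝ, 0 < σ ∧ 3 * σ + Fintype.card ι * √(3 * Q * σ) < γ := by
    have hc : Continuous (fun σ : ℝ => 3 * σ + Fintype.card ι * √(3 * Q * σ)) := by fun_prop
    have h1 := (hc.tendsto 0).eventually (gt_mem_nhds (show 3 * (0 : ℝ) + Fintype.card ι * √(3 * Q * 0) < γ by simpa using hγ0))
    have h2 : ∀ᶠ σ in 𝓝[>] (0 : ℝ), 3 * σ + Fintype.card ι * √(3 * Q * σ) < γ :=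
      h1.filter_mono nhdsWithin_le_nhds
    obtain ⟨σ, h3, h4⟩ := (h2.and self_mem_nhdsWithin).exists
    exact ⟨σ, h4, h3⟩
  have hη : 0 < σ / (3 * q) := by positivity
  obtain ⟨s, h, r, w, hs, hhm, hh, hr, hw, hdec, hrinv, hrη, ⟨Cw, hCw⟩, hw0⟩ :=
    hEM.vdecomp l m hl v hvc hvinv _ hη
  set Hs := ∑ z ∈ s, ∫ p, ‖h z p‖ ∂M with hHs
  have hHs0 : 0 ≤ Hs := Finset.sum_nonneg fun z _ => integral_nonneg fun p => norm_nonneg _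
  have hsc : (0 : ℝ) < s.card := by exact_mod_cast hs.card_pos
  set s0 := σ / (3 * (Hs + 1)) with hs0def
  have hs0 : 0 < s0 := by positivity
  set e := min (1 / 2) (σ * s0 / (12 * s.card * (Hs + 1))) with hedef
  have he0 : 0 < e := lt_min (by norm_num) (by positivity)
  have he1 : e < 1 := lt_of_le_of_lt (min_le_left _ _) (by norm_num)
  obtain ⟨R, hR0, hR1⟩ := hEM.exists_R s hs e he0 he1
  set k : Ωβ → Ωβ → ℝ := fun p' p => cv s p' p ^ R with hk
  have hkT : PosTrig k := (cv_posTrig s).pow R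
  have hk0 : ∀ p' p, 0 ≤ k p' p := fun _ _ => pow_nonneg (cv_nonneg _ _ _) _
  have hvi : ∀ n, Integrable (v n) M := fun n => cont_integrable_real (hvc n)
  have hσb : q * kap M k * (σ / (3 * q)) + Hs * (s0 * kap M k + 4 * s.card / s0 *
      (kap M k - kap M (fun p' p => cv s p' p ^ (R + 1)))) ≤ kap M k * σ := by
    have a1 : q * kap M k * (σ / (3 * q)) = kap M k * (σ / 3) := by field_simp
    have a2 : Hs * s0 ≤ σ / 3 := by
      rw [hs0def, mul_div_assoc', div_le_div_iff₀ (by positivity) (by norm_num)]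
      nlinarith
    have a3 : kap M k - kap M (fun p' p => cv s p' p ^ (R + 1)) ≤ e * kap M k := by linarith
    have a4 : Hs * (4 * s.card / s0) * e ≤ σ / 3 := by
      have : Hs * (4 * s.card / s0) * e ≤
          Hs * (4 * s.card / s0) * (σ * s0 / (12 * s.card * (Hs + 1))) :=
        mul_le_mul_of_nonneg_left (min_le_right _ _) (by positivity)
      refine this.trans ?_
      have h5 : Hs * (4 * s.card / s0) * (σ * s0 / (12 * s.card * (Hs + 1))) =
          (Hs / (Hs + 1)) * (σ / 3) := by field_simp; ring
      rw [h5]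
      refine mul_le_of_le_one_left (by positivity) ?_
      rw [div_le_one (by positivity)]; linarith
    have a5 : Hs * (4 * s.card / s0) * (kap M k - kap M (fun p' p => cv s p' p ^ (R + 1))) ≤
        (σ / 3) * kap M k := by
      refine (mul_le_mul_of_nonneg_left a3 (by positivity)).trans ?_
      rw [← mul_assoc]
      exact mul_le_mul_of_nonneg_right a4 hR0.le
    have a6 := mul_le_mul_of_nonneg_right a2 hR0.le
    rw [a1]
    linarith
  let et : Ωβ → ℂ := fun p => ∑ z ∈ s, Zc z p * h z p
  have hetm : Measurable et := by
    refine Finset.measurable_sum _ fun z _ => ?_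
    exact (Zc_continuous z).measurable.mul (hhm z)
  have heti : Integrable et M := integrable_finsetSum _ fun z _ =>
    Integrable.bdd_mul (c := 1) (hh z) (Zc_continuous _).aestronglyMeasurable
          (Eventually.of_forall fun p => (Zc_norm _ _).le)
  have hfin := hEM.endgame hkT hk0 hR0 hQ v hvc hv0 hvQ (fun p => (et p).re)
    (Complex.measurable_re.comp hetm) heti.re hσ0.le ?_ (γ := γ) ?_ G hG hGc pat hpat W hbad
  · linarith
  · intro a ha f hf hf1
    have h1 := hEM.kcompare l m hl v hvi hs hh hr hw hdec hrinv hrη hCw hw0 R s0 hs0 a ha f hf hf1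
    have h2 := (Complex.abs_re_le_norm _).trans (h1.trans hσb)
    rw [Complex.sub_re] at h2
    have hfC : ∀ p, ‖(f p : ℂ)‖ ≤ 1 := fun p => by
      rw [Complex.norm_real, Real.norm_of_nonneg (hf1 p).1]; exact (hf1 p).2
    have hfi : ∀ {F : Ωβ → ℂ}, Integrable F M → Integrable (fun p => (f p : ℂ) * F p) M := fun hF =>
      Integrable.bdd_mul (c := 1) hF (by fun_prop) (Eventually.of_forall hfC)
    have haB : BddSeq (fun n => (a n : ℂ)) := ⟨1, fun n => by
      rw [Complex.norm_real, Real.norm_of_nonneg (ha n).1]; exact (ha n).2⟩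
    have e1 : E (fun n => (a n : ℂ) * ∫ p, ((cv s (pure n) p ^ R : ℝ) : ℂ) * ((f p : ℂ) * (v n p : ℂ)) ∂M)
        = E (fun n => ((a n * ∫ p, k (pure n) p * (f p * v n p) ∂M : ℝ) : ℂ)) := by
      congr 1; ext n
      rw [Complex.ofReal_mul, kint_ofReal]
      simp only [Complex.ofReal_mul, hk]
    have e2 : (E (fun n => (a n : ℂ) * ∫ p, ((cv s (pure n) p ^ R : ℝ) : ℂ) * ((f p : ℂ) * et p) ∂M)).re
        = ER E (fun n => a n * ∫ p, k (pure n) p * (f p * (et p).re) ∂M) := by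
      have hb : BddSeq (fun n => ∫ p, (k (pure n) p : ℂ) * ((f p : ℂ) * et p) ∂M) :=
        hEM.bdd_kint hkT (F := fun _ p => (f p : ℂ) * et p) (fun _ => hfi heti) (fun _ => le_rfl) 0
      rw [hEM.mean.re_E (haB.mul hb)]
      congr 1; ext n
      rw [Complex.re_ofReal_mul]
      congr 1
      have h3 := integral_re (k_mul_integrable hkT (pure n) (hfi heti))
      have h4 : ∀ z : ℂ, RCLike.re z = z.re := fun _ => rfl
      simp only [h4, Complex.re_ofReal_mul] at h3
      exact h3.symm
    rw [e1] at h2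
    change |_ - (E (fun n => (a n : ℂ) * ∫ p, ((cv s (pure n) p ^ R : ℝ) : ℂ) *
      ((f p : ℂ) * et p) ∂M)).re| ≤ _ at h2
    rw [e2] at h2
    exact h2
  · rw [hEM.v_kint hkT l m v g hgc hgC hginv hvg hδ, ← hq, hγ]
    linarith

end mainabs

open Filter MeasureTheory Topology

section core
open scoped Classical

/-- symbolic coordinates -/
def xs (l : ℕ) (S : Set ℕ) (j : ℕ) (p : Ωβ) : Prop := {s : ℕ | l * s + j ∈ S} ∈ p

lemma xs_pure (l : ℕ) (S : Set ℕ) (j n : ℕ) : xs l S j (pure n) ↔ l * n + j ∈ S := Iff.rfl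

lemma xs_clopen (l : ℕ) (S : Set ℕ) (j : ℕ) : IsClopen {p | xs l S j p} :=
  ⟨ultrafilter_isClosed_basic _, ultrafilter_isOpen_basic _⟩

lemma xs_shift (l : ℕ) (S : Set ℕ) (j : ℕ) (p : Ωβ) : xs l S j (bshift p) ↔ xs l S (j + l) p := by
  unfold xs
  rw [mem_bshift]
  have : {n : ℕ | n + 1 ∈ {s : ℕ | l * s + j ∈ S}} = {s : ℕ | l * s + (j + l) ∈ S} := by
    ext n
    show l * (n + 1) + j ∈ S ↔ l * n + (j + l) ∈ S
    rw [show l * (n + 1) + j = l * n + (j + l) by ring]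
  rw [this]

/-- indicator of a symbolic coordinate -/
noncomputable def Xi (l : ℕ) (S : Set ℕ) (j : ℕ) (p : Ωβ) : ℝ := if xs l S j p then 1 else 0

lemma Xi_cont (l : ℕ) (S : Set ℕ) (j : ℕ) : Continuous (Xi l S j) := by
  have : Xi l S j = {p | xs l S j p}.indicator (fun _ => (1 : ℝ)) := by
    ext p
    simp [Xi, Set.indicator_apply]
  rw [this]
  exact Continuous.indicator (by simp [(xs_clopen l S j).frontier_eq]) continuous_const

lemma Xi_shift (l : ℕ) (S : Set ℕ) (j t : ℕ) (p : Ωβ) :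
    Xi l S j (bshift^[t] p) = Xi l S (j + l * t) p := by
  induction t generalizing j with
  | zero => rfl
  | succ t ih =>
    rw [Function.iterate_succ_apply', Xi, xs_shift, ← Xi, ih]
    congr 1; ring

lemma Xi_01 (l : ℕ) (S : Set ℕ) (j : ℕ) (p : Ωβ) : 0 ≤ Xi l S j p ∧ Xi l S j p ≤ 1 := by
  unfold Xi; split_ifs <;> simp

lemma sum_range_mul_split (f : ℕ → ℝ) (q l : ℕ) :
    ∑ t ∈ Finset.range (q * l), f t = ∑ i ∈ Finset.range q, ∑ t ∈ Finset.range l, f (t + l * i) := by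
  induction q with
  | zero => simp
  | succ q ih =>
    rw [Nat.add_mul, one_mul, Finset.sum_range_add, ih, Finset.sum_range_succ]
    congr 1
    refine Finset.sum_congr rfl fun t _ => ?_
    congr 1; ring

lemma periodic_sum (ξ : ℕ → ℝ) (l : ℕ) (h : ∀ j, ξ (j + l) = ξ j) (j : ℕ) :
    ∑ t ∈ Finset.range l, ξ (j + t) = ∑ t ∈ Finset.range l, ξ t := by
  induction j with
  | zero => simp
  | succ j ih =>
    rw [← ih]
    have h1 := Finset.sum_range_succ (fun t => ξ (j + t)) l
    have h2 := Finset.sum_range_succ' (fun t => ξ (j + t)) l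
    rw [h1] at h2
    simp only [add_zero, h] at h2
    have h3 : ∀ t, j + 1 + t = j + (t + 1) := fun t => by ring
    simp_rw [h3]
    linarith

theorem core (l m : ℕ) (hl : 0 < l) (S : Set ℕ) (c L : ℕ → ℕ)
    (hL : Tendsto L atTop atTop) (δ : ℝ) (hδ : 0 < δ)
    (hdens : ∀ i, δ * L i ≤ ∑ n ∈ Finset.range (L i), ∑ j ∈ Finset.range l,
      if l * (c i + n) + j ∈ S then (1 : ℝ) else 0) :
    ∃ x : ℕ → Prop, ∀ W, ∃ n ≥ W, (∀ j ≤ W, (l * n + j ∈ S ↔ x j)) ∧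
      ∃ t < (l + m) * l, x (m * n + t) := by
  by_contra hcon
  push Not at hcon
  obtain ⟨E, hE, hEd⟩ := exists_mean c L hL
  obtain ⟨M, hM1, hM2, hM3⟩ := exists_measure hE
  have hEM : MeanMeas E M := ⟨hE, hM1, hM2, hM3⟩
  let v : ℕ → Ωβ → ℝ := fun n p => ∑ t ∈ Finset.range ((l + m) * l), Xi l S (m * n + t) p
  let g : ℕ → Ωβ → ℝ := fun n p => ∑ t ∈ Finset.range l, Xi l S (m * n + t) p
  have hXi : ∀ j, Integrable (Xi l S j) M := fun j => cont_integrable_real (Xi_cont l S j)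
  have hvc : ∀ n, Continuous (v n) := fun n => continuous_finset_sum _ fun t _ => Xi_cont l S _
  have hgc : ∀ n, Continuous (g n) := fun n => continuous_finset_sum _ fun t _ => Xi_cont l S _
  have hv0 : ∀ n p, 0 ≤ v n p := fun n p => Finset.sum_nonneg fun t _ => (Xi_01 l S _ p).1
  have hg0 : ∀ n p, 0 ≤ g n p := fun n p => Finset.sum_nonneg fun t _ => (Xi_01 l S _ p).1
  have hvQ : ∀ n p, v n p ≤ (((l + m) * l : ℕ) : ℝ) := fun n p => by
    refine (Finset.sum_le_card_nsmul _ _ 1 fun t _ => (Xi_01 l S _ p).2).trans ?_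
    simp
  have hgQ : ∀ n p, |g n p| ≤ (l : ℝ) := fun n p => by
    rw [abs_of_nonneg (hg0 n p)]
    refine (Finset.sum_le_card_nsmul _ _ 1 fun t _ => (Xi_01 l S _ p).2).trans ?_
    simp
  have hQ : (0 : ℝ) < (((l + m) * l : ℕ) : ℝ) := by
    exact_mod_cast Nat.mul_pos (by omega) hl
  have hvinv : ∀ n p, v (n + l) p = v n (bshift^[m] p) := by
    intro n p
    refine Finset.sum_congr rfl fun t _ => ?_
    rw [Xi_shift]; congr 1; ring
  have hginv : ∀ n p, g (n + l) p = g n (bshift^[m] p) := by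
    intro n p
    refine Finset.sum_congr rfl fun t _ => ?_
    rw [Xi_shift]; congr 1; ring
  have hvg : ∀ n p, v n p = ∑ t ∈ Finset.range (l + m), g n (bshift^[t] p) := by
    intro n p
    simp only [v, g]
    rw [sum_range_mul_split]
    refine Finset.sum_congr rfl fun i _ => Finset.sum_congr rfl fun t _ => ?_
    rw [Xi_shift]; congr 1; ring
  let ξ : ℕ → ℝ := fun j => ∫ p, Xi l S j p ∂M
  have hξ : ∀ j, ξ (j + l) = ξ j := by
    intro j
    have h1 : ξ j = ∫ p, Xi l S j (bshift p) ∂M := by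
      simp only [ξ]
      conv_lhs => rw [← hM2.map_eq]
      rw [integral_map hM2.measurable.aemeasurable]
      exact (Xi_cont l S j).aestronglyMeasurable
    rw [h1]
    have h2 : ∀ p, Xi l S j (bshift p) = Xi l S (j + l) p := fun p => by
      have := Xi_shift l S j 1 p
      rwa [mul_one] at this
    simp_rw [h2]
    rfl
  have hgint : ∀ n, ∫ p, g n p ∂M = ∑ t ∈ Finset.range l, ξ t := by
    intro n
    simp only [g]
    rw [integral_finsetSum _ fun t _ => hXi _]
    exact periodic_sum ξ l hξ (m * n)
  have hδ' : δ ≤ ∑ t ∈ Finset.range l, ξ t := by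
    have h1 := hEd (fun n => ∑ j ∈ Finset.range l, if l * n + j ∈ S then (1 : ℝ) else 0)
      ⟨l, fun n => by
        rw [abs_of_nonneg (Finset.sum_nonneg fun j _ => by split_ifs <;> simp)]
        refine (Finset.sum_le_card_nsmul _ _ 1 fun t _ => by split_ifs <;> simp).trans ?_
        simp⟩ δ hdens
    refine h1.trans (le_of_eq ?_)
    have h2 := hM3 ⟨fun p => ((∑ t ∈ Finset.range l, Xi l S t p : ℝ) : ℂ), by
      have := Xi_cont l S
      fun_prop⟩
    simp only [ContinuousMap.coe_mk] at h2
    rw [integral_complex_ofReal, integral_finsetSum _ fun t _ => hXi _] at h2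
    have h3 := congrArg Complex.re h2
    rw [Complex.ofReal_re] at h3
    rw [h3]
    rfl
  have hδ0 : 0 < ∑ t ∈ Finset.range l, ξ t := lt_of_lt_of_le hδ hδ'
  let G : ℕ → Set Ωβ := fun W => {p | ∀ n ≥ W, (∀ j ≤ W, (l * n + j ∈ S ↔ xs l S j p)) → v n p = 0}
  have hGm : ∀ W, MeasurableSet (G W) := by
    intro W
    have : G W = ⋂ n, ⋂ (_ : n ≥ W), ({p | ∀ j ≤ W, (l * n + j ∈ S ↔ xs l S j p)}ᶜ ∪ {p | v n p = 0}) := by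
      ext p
      simp only [G, Set.mem_iInter, Set.mem_union, Set.mem_compl_iff, Set.mem_ofPred_eq]
      refine forall_congr' fun n => forall_congr' fun hn => ?_
      exact imp_iff_not_or
    rw [this]
    refine MeasurableSet.iInter fun n => MeasurableSet.iInter fun _ => ?_
    refine MeasurableSet.union (MeasurableSet.compl ?_) ?_
    · have : {p | ∀ j ≤ W, (l * n + j ∈ S ↔ xs l S j p)} =
          ⋂ j, ⋂ (_ : j ≤ W), {p | (l * n + j ∈ S ↔ xs l S j p)} := by
        ext p
        simp only [Set.mem_iInter, Set.mem_ofPred_eq]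
      rw [this]
      refine MeasurableSet.iInter fun j => MeasurableSet.iInter fun _ => ?_
      by_cases hj : l * n + j ∈ S
      · simp only [hj, true_iff]; exact (xs_clopen l S j).isOpen.measurableSet
      · simp only [hj, false_iff]; exact (xs_clopen l S j).isOpen.measurableSet.compl
    · exact (isClosed_singleton.preimage (hvc n)).measurableSet
  have hGmono : Monotone G := by
    intro W W' hW p hp n hn hj
    exact hp n (hW.trans hn) fun j hjW => hj j (hjW.trans hW)
  have hGun : ⋃ W, G W = Set.univ := by
    refine Set.eq_univ_of_forall fun p => ?_
    obtain ⟨W, hW⟩ := hcon (fun j => xs l S j p)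
    refine Set.mem_iUnion.mpr ⟨W, fun n hn hj => ?_⟩
    refine Finset.sum_eq_zero fun t ht => ?_
    have := hW n hn hj t (Finset.mem_range.mp ht)
    simp [Xi, this]
  obtain ⟨W, hW⟩ : ∃ W, (((l + m) * l : ℕ) : ℝ) * M.real (G W)ᶜ ≤
      (l + m : ℕ) * (∑ t ∈ Finset.range l, ξ t) / 2 := by
    have h1 := tendsto_measure_iUnion_atTop (μ := M) hGmono
    rw [hGun, measure_univ] at h1
    have h2 : Tendsto (fun W => M.real (G W)) atTop (𝓝 1) :=
      (ENNReal.tendsto_toReal (by simp)).comp h1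
    have h3 : Tendsto (fun W => (((l + m) * l : ℕ) : ℝ) * M.real (G W)ᶜ) atTop (𝓝 0) := by
      have h4 : ∀ W, M.real (G W)ᶜ = 1 - M.real (G W) := fun W => probReal_compl_eq_one_sub (hGm W)
      simp_rw [h4]
      have h5 := (h2.const_sub 1).const_mul (((l + m) * l : ℕ) : ℝ)
      simpa using h5
    have hpos : 0 < ((l + m : ℕ) : ℝ) * (∑ t ∈ Finset.range l, ξ t) / 2 := by
      have : (0 : ℝ) < ((l + m : ℕ) : ℝ) := by exact_mod_cast (by omega : 0 < l + m)
      positivity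
    obtain ⟨W, hW⟩ := (h3.eventually (gt_mem_nhds hpos)).exists
    exact ⟨W, hW.le⟩
  let pat : Ωβ → (Fin (W + 1) → Bool) := fun p j => decide (xs l S j p)
  refine hEM.main_abs l m hl hQ v g hvc hv0 hvQ hvinv hgc hgQ hginv hvg hgint hδ0 (G W) (hGm W) hW
    pat ?_ W ?_
  · intro u
    have : pat ⁻¹' {u} = ⋂ j : Fin (W + 1), {p | decide (xs l S j p) = u j} := by
      ext p
      simp only [Set.mem_preimage, Set.mem_singleton_iff, Set.mem_iInter, Set.mem_ofPred_eq, pat]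
      exact funext_iff
    rw [this]
    refine isClopen_iInter_of_finite fun j => ?_
    cases u j
    · simp only [decide_eq_false_iff_not]
      exact (xs_clopen l S j).compl
    · simp only [decide_eq_true_eq]
      exact xs_clopen l S j
  · intro p hp n hn hpn
    refine hp n hn fun j hj => ?_
    have := congrFun hpn ⟨j, by omega⟩
    simp only [pat, decide_eq_decide, xs_pure] at this
    exact this

end core


section final
open scoped Classical

lemma reduction_window (A : Set ℕ) (q l : ℕ) (hq : 0 < q) (hl : 0 < l) (ε : ℝ) (hε : 0 < ε)
    (M N : ℕ) (hN : 2 * (q * l) ≤ N)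
    (h : (1 - 1 / (q : ℝ) + ε) * N ≤ (((Finset.Ico M (M + N)).filter (· ∈ A)).card : ℝ)) :
    ∃ c : ℕ, ε * q * l * ((N / (q * l) - 1 : ℕ) : ℝ) - 2 * l ≤
      ∑ n ∈ Finset.range (N / (q * l) - 1), ∑ j ∈ Finset.range l,
        if l * (c + n) + j ∈ {k | q * k ∈ A} then (1 : ℝ) else 0 := by
  have hql : 0 < q * l := Nat.mul_pos hq hl
  obtain ⟨L, hL⟩ : ∃ L, N / (q * l) = L + 1 := by
    have : 2 ≤ N / (q * l) := (Nat.le_div_iff_mul_le hql).2 hN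
    exact ⟨N / (q * l) - 1, by omega⟩
  have hL' : N / (q * l) - 1 = L := by omega
  rw [hL']
  have hN1 : q * l * (L + 1) ≤ N := by rw [← hL]; exact Nat.mul_div_le N (q * l)
  have hN2 : N ≤ q * l * (L + 2) := by
    have := Nat.lt_mul_div_succ N hql
    rw [hL] at this
    exact this.le
  set c := M / (q * l) + 1 with hc
  have hc1 : M ≤ q * l * c := (Nat.lt_mul_div_succ M hql).le
  have hc2 : q * l * c ≤ M + q * l := by
    have := Nat.mul_div_le M (q * l)
    rw [hc, Nat.mul_add]; omega
  refine ⟨c, ?_⟩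
  have hsum : ∑ n ∈ Finset.range L, ∑ j ∈ Finset.range l,
        (if l * (c + n) + j ∈ {k | q * k ∈ A} then (1 : ℝ) else 0)
      = (((Finset.range (L * l)).filter (fun t => q * (l * c + t) ∈ A)).card : ℝ) := by
    rw [Finset.card_filter]
    push_cast
    rw [sum_range_mul_split (fun t => if q * (l * c + t) ∈ A then (1 : ℝ) else 0) L l]
    refine Finset.sum_congr rfl fun n _ => Finset.sum_congr rfl fun j _ => ?_
    have : l * (c + n) + j = l * c + (j + l * n) := by ring
    simp only [this, Set.mem_ofPred_eq]
  rw [hsum]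
  have hsplit := Finset.card_filter_add_card_filter_not (s := Finset.range (L * l))
    (fun t => q * (l * c + t) ∈ A)
  have hsplit2 := Finset.card_filter_add_card_filter_not (s := Finset.Ico M (M + N))
    (fun t => t ∈ A)
  rw [Finset.card_range] at hsplit
  rw [Nat.card_Ico, Nat.add_sub_cancel_left] at hsplit2
  have hinj : ((Finset.range (L * l)).filter (fun t => ¬ q * (l * c + t) ∈ A)).card ≤
      ((Finset.Ico M (M + N)).filter (fun t => ¬ t ∈ A)).card := by
    refine Finset.card_le_card_of_injOn (fun t => q * (l * c + t)) ?_ ?_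
    · intro t ht
      simp only [Finset.coe_filter, Finset.mem_range, Finset.mem_Ico, Set.mem_ofPred_eq] at ht ⊢
      refine ⟨⟨?_, ?_⟩, ht.2⟩
      · calc M ≤ q * l * c := hc1
          _ ≤ q * (l * c + t) := by nlinarith
      · have h1 : q * t < q * (L * l) := Nat.mul_lt_mul_of_pos_left ht.1 hq
        nlinarith
    · intro a _ b _ hab
      simp only at hab
      have := Nat.eq_of_mul_eq_mul_left hq hab
      omega
  have r1 : (((Finset.range (L * l)).filter (fun t => q * (l * c + t) ∈ A)).card : ℝ) +
    (((Finset.range (L * l)).filter (fun t => ¬ q * (l * c + t) ∈ A)).card : ℝ) = L * l := by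
    exact_mod_cast hsplit
  have r2 : (((Finset.Ico M (M + N)).filter (fun t => t ∈ A)).card : ℝ) +
      (((Finset.Ico M (M + N)).filter (fun t => ¬ t ∈ A)).card : ℝ) = N := by
    exact_mod_cast hsplit2
  have r3 : (((Finset.range (L * l)).filter (fun t => ¬ q * (l * c + t) ∈ A)).card : ℝ) ≤
      (((Finset.Ico M (M + N)).filter (fun t => ¬ t ∈ A)).card : ℝ) := by
    exact_mod_cast hinj
  have r4 : (q : ℝ) * l * (L + 1) ≤ N := by exact_mod_cast hN1
  have r5 : (N : ℝ) ≤ q * l * (L + 2) := by exact_mod_cast hN2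
  have hq0 : (0 : ℝ) < q := by exact_mod_cast hq
  have hl0 : (0 : ℝ) < l := by exact_mod_cast hl
  have r6 : 1 / (q : ℝ) * N ≤ l * (L + 2) := by
    rw [one_div, inv_mul_le_iff₀ hq0]; linarith
  have r7 : ε * (q * l * L) ≤ ε * N := by
    refine mul_le_mul_of_nonneg_left ?_ hε.le
    nlinarith [mul_pos hq0 hl0]
  linarith

lemma exists_window (A : Set ℕ) (a : ℝ) (h : a < upperBanachDensity A) (N₀ : ℕ) :
    ∃ N ≥ N₀, ∃ M, a * N ≤ (((Finset.Ico M (M + N)).filter (· ∈ A)).card : ℝ) := by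
  unfold upperBanachDensity at h
  have hf := Filter.frequently_lt_of_lt_limsup (by
    refine Filter.IsCoboundedUnder.of_frequently_ge (a := 0) ?_
    exact Filter.Frequently.of_forall fun N => Real.iSup_nonneg fun M => by positivity) h
  obtain ⟨N, hlt, hN⟩ := (hf.and_eventually (Filter.eventually_ge_atTop (max N₀ 1))).exists
  obtain ⟨M, hM⟩ := exists_lt_of_lt_ciSup hlt
  have hN1 : (0 : ℝ) < N := by
    have : 1 ≤ N := le_trans (le_max_right _ _) hN
    exact_mod_cast this
  exact ⟨N, le_trans (le_max_left _ _) hN, M, ((lt_div_iff₀ hN1).1 hM).le⟩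

lemma combinatorial (l m T : ℕ) (S : Set ℕ) (x : ℕ → Prop)
    (hx : ∀ W, ∃ n ≥ W, (∀ j ≤ W, (l * n + j ∈ S ↔ x j)) ∧ ∃ t < T, x (m * n + t)) :
    ∃ t, ∃ b : ℕ → ℕ, StrictMono b ∧ ∀ i k, i < k → m * b i + l * b k + t ∈ S := by
  have hp : ∃ t < T, ∀ W, ∃ n ≥ W, (∀ j ≤ W, (l * n + j ∈ S ↔ x j)) ∧ x (m * n + t) := by
    by_contra hcon
    push Not at hcon
    choose! w hw using hcon
    obtain ⟨n, hn, hj, t, ht, hxt⟩ := hx ((Finset.range T).sup w)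
    have hle : w t ≤ (Finset.range T).sup w := Finset.le_sup (Finset.mem_range.2 ht)
    exact hw t ht n (le_trans hle hn) (fun j hj' => hj j (le_trans hj' hle)) hxt
  obtain ⟨t, -, ht⟩ := hp
  choose f hf1 hf2 hf3 using ht
  let b : ℕ → ℕ := fun k => Nat.rec (f 0) (fun _ v => f ((m + 1) * v + t + 1)) k
  have hb : ∀ k, b (k + 1) = f ((m + 1) * b k + t + 1) := fun k => rfl
  have hlt : ∀ k, b k < b (k + 1) := by
    intro k
    rw [hb]
    have := hf1 ((m + 1) * b k + t + 1)
    nlinarith [Nat.zero_le (m * b k)]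
  have hmono : StrictMono b := strictMono_nat_of_lt_succ hlt
  have hxb : ∀ k, x (m * b k + t) := by
    intro k
    cases k with
    | zero => exact hf3 0
    | succ k => rw [hb]; exact hf3 _
  refine ⟨t, b, hmono, fun i k hik => ?_⟩
  obtain ⟨k, rfl⟩ : ∃ k', k = k' + 1 := ⟨k - 1, by omega⟩
  have hle : b i ≤ b k := hmono.monotone (by omega)
  have h1 : m * b i + t ≤ (m + 1) * b k + t + 1 := by nlinarith [Nat.mul_le_mul_left m hle]
  have := (hf2 ((m + 1) * b k + t + 1) (m * b i + t) h1).2 (hxb i)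
  rw [← hb] at this
  have e : m * b i + l * b (k + 1) + t = l * b (k + 1) + (m * b i + t) := by ring
  rwa [e]

lemma main_part (l m : ℕ) (hl : 0 < l) (hm : 0 < m) (A : Set ℕ)
    (hA : upperBanachDensity A > 1 - 1 / ((l : ℝ) + m)) :
    ∃ B : Set ℕ, B.Infinite ∧ ∀ b₁ ∈ B, ∀ b₂ ∈ B, b₁ < b₂ → m * b₁ + l * b₂ ∈ A := by
  have hq : 0 < l + m := by omega
  have hql : 0 < (l + m) * l := Nat.mul_pos hq hl
  have hq0 : (0 : ℝ) < ((l + m : ℕ) : ℝ) := by exact_mod_cast hq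
  have hl0 : (0 : ℝ) < l := by exact_mod_cast hl
  obtain ⟨a, ha1, ha2⟩ := exists_between hA
  obtain ⟨ε, hε, rfl⟩ : ∃ ε > 0, a = 1 - 1 / ((l + m : ℕ) : ℝ) + ε :=
    ⟨a - (1 - 1 / ((l : ℝ) + m)), by linarith, by push_cast; ring⟩
  obtain ⟨K, hK⟩ := exists_nat_ge (4 / (ε * ((l + m : ℕ) : ℝ)))
  have hK' : 4 ≤ ε * ((l + m : ℕ) : ℝ) * K := by
    rw [div_le_iff₀ (by positivity)] at hK; linarith
  have key : ∀ i : ℕ, ∃ c L : ℕ, i ≤ L ∧ ε * ((l + m : ℕ) : ℝ) * l / 2 * L ≤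
      ∑ n ∈ Finset.range L, ∑ j ∈ Finset.range l,
        if l * (c + n) + j ∈ {k | (l + m) * k ∈ A} then (1 : ℝ) else 0 := by
    intro i
    obtain ⟨N, hN, M, hM⟩ := exists_window A _ ha2 ((K + i + 2) * ((l + m) * l))
    obtain ⟨c, hc⟩ := reduction_window A (l + m) l hq hl ε hε M N (by nlinarith) hM
    have hL : K + i + 2 ≤ N / ((l + m) * l) := (Nat.le_div_iff_mul_le hql).2 hN
    refine ⟨c, N / ((l + m) * l) - 1, by omega, le_trans ?_ hc⟩
    have hKL : (K : ℝ) ≤ ((N / ((l + m) * l) - 1 : ℕ) : ℝ) := by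
      exact_mod_cast (by omega : K ≤ N / ((l + m) * l) - 1)
    have h1 : 4 ≤ ε * ((l + m : ℕ) : ℝ) * ((N / ((l + m) * l) - 1 : ℕ) : ℝ) :=
      le_trans hK' (mul_le_mul_of_nonneg_left hKL (by positivity))
    nlinarith [mul_le_mul_of_nonneg_left h1 hl0.le]
  choose c L hL hdens using key
  obtain ⟨x, hx⟩ := core l m hl {k | (l + m) * k ∈ A} c L
    (tendsto_atTop_mono hL tendsto_id) (ε * ((l + m : ℕ) : ℝ) * l / 2) (by positivity) hdens
  obtain ⟨t, b, hb, hbS⟩ := combinatorial l m ((l + m) * l) _ x hx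
  have hmono : StrictMono (fun k => (l + m) * b k + t) := fun i j hij =>
    Nat.add_lt_add_right (Nat.mul_lt_mul_of_pos_left (hb hij) hq) t
  refine ⟨Set.range (fun k => (l + m) * b k + t), Set.infinite_range_of_injective hmono.injective, ?_⟩
  rintro _ ⟨i, rfl⟩ _ ⟨k, rfl⟩ hlt
  have hik : i < k := hmono.lt_iff_lt.1 hlt
  have := hbS i k hik
  simp only [Set.mem_ofPred_eq] at this
  have e : m * ((l + m) * b i + t) + l * ((l + m) * b k + t)
    = (l + m) * (m * b i + l * b k + t) := by ring
  simp only [e]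
  exact this

end final

lemma density_part (q : ℕ) (hq : 0 < q) :
    Filter.Tendsto
      (fun N : ℕ => (((Finset.Icc 1 N).filter (fun n => ¬ q ∣ n)).card : ℝ) / N)
      Filter.atTop (nhds (1 - 1 / (q : ℝ))) := by
  have hq0 : (0 : ℝ) < q := by exact_mod_cast hq
  have hcount : ∀ N : ℕ, (((Finset.Icc 1 N).filter (fun n => ¬ q ∣ n)).card : ℝ)
      = N - (N / q : ℕ) := by
    intro N
    have h1 := Finset.card_filter_add_card_filter_not (s := Finset.Icc 1 N) (fun n => q ∣ n)
    have h2 : ((Finset.Icc 1 N).filter (fun n => q ∣ n)).card = N / q := by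
      have := Nat.Ioc_filter_dvd_card_eq_div N q
      rw [← this]
      congr 1
    rw [h2, Nat.card_Icc, Nat.add_sub_cancel] at h1
    have : ((N / q : ℕ) : ℝ) + (((Finset.Icc 1 N).filter (fun n => ¬ q ∣ n)).card : ℝ) = N := by
      exact_mod_cast h1
    linarith
  have hlim : Tendsto (fun N : ℕ => ((N / q : ℕ) : ℝ) / N) atTop (nhds (1 / (q : ℝ))) := by
    have h1 : Tendsto (fun N : ℕ => 1 / (q : ℝ) - 1 / (N : ℝ)) atTop (nhds (1 / (q : ℝ))) := by
      simpa using (tendsto_one_div_atTop_nhds_zero_nat (𝕜 := ℝ)).const_sub (1 / (q : ℝ))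
    refine tendsto_of_tendsto_of_tendsto_of_le_of_le' h1 tendsto_const_nhds ?_ ?_
    · filter_upwards [eventually_gt_atTop 0] with N hN
      have hN0 : (0 : ℝ) < N := by exact_mod_cast hN
      have h2 : (N : ℝ) < q * ((N / q : ℕ) + 1) := by exact_mod_cast Nat.lt_mul_div_succ N hq
      rw [div_sub_div _ _ hq0.ne' hN0.ne', div_le_div_iff₀ (by positivity) hN0]
      nlinarith
    · filter_upwards [eventually_gt_atTop 0] with N hN
      have hN0 : (0 : ℝ) < N := by exact_mod_cast hN
      have h2 : (q : ℝ) * (N / q : ℕ) ≤ N := by exact_mod_cast Nat.mul_div_le N q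
      rw [div_le_div_iff₀ hN0 hq0]
      linarith
  refine (hlim.const_sub 1).congr' ?_
  filter_upwards [eventually_gt_atTop 0] with N hN
  have hN0 : (N : ℝ) ≠ 0 := by exact_mod_cast hN.ne'
  rw [hcount, sub_div, div_self hN0]

lemma optimal_part (l m : ℕ) (hl : 0 < l) (B : Set ℕ) (hB : B.Infinite) :
    ¬ (∀ b₁ ∈ B, ∀ b₂ ∈ B, b₁ < b₂ → ¬ (l + m) ∣ (m * b₁ + l * b₂)) := by
  intro h
  obtain ⟨a, ha, b, hb, hne, hab⟩ := hB.exists_ne_map_eq_of_mapsTo (f := fun n => n % (l + m))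
    (t := Set.Iio (l + m)) (fun n _ => Nat.mod_lt _ (by omega)) (Set.finite_Iio _)
  have key : ∀ u v : ℕ, u % (l + m) = v % (l + m) → (l + m) ∣ (m * u + l * v) := by
    intro u v huv
    have h1 : m * u + l * v ≡ m * u + l * u [MOD (l + m)] :=
      Nat.ModEq.add_left _ (Nat.ModEq.mul_left _ (Eq.symm huv))
    refine (Nat.ModEq.dvd_iff h1 dvd_rfl).2 ⟨u, by ring⟩
  rcases lt_or_gt_of_ne hne with hlt | hlt
  · exact h a ha b hb hlt (key a b hab)
  · exact h b hb a ha hlt (key b a hab.symm)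


/-- If `d*(A) > 1 - 1/(ℓ+m)` then `A` contains a sumset `{m b₁ + ℓ b₂ : b₁ < b₂ ∈ B}` for
some infinite `B`; moreover the threshold is optimal: the set of naturals not divisible by
`ℓ+m` has natural density `1 - 1/(ℓ+m)` and contains no such sumset. -/
theorem mB_add_lB_unshifted_threshold (ℓ m : ℕ) (hℓ : 0 < ℓ) (hm : 0 < m) :
    (∀ A : Set ℕ, upperBanachDensity A > 1 - 1 / ((ℓ : ℝ) + m) →
      ∃ B : Set ℕ, B.Infinite ∧
        ∀ b₁ ∈ B, ∀ b₂ ∈ B, b₁ < b₂ → m * b₁ + ℓ * b₂ ∈ A) ∧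
    Filter.Tendsto
      (fun N : ℕ => (((Finset.Icc 1 N).filter (fun n => ¬ (ℓ + m) ∣ n)).card : ℝ) / N)
      Filter.atTop (nhds (1 - 1 / ((ℓ : ℝ) + m))) ∧
    ∀ B : Set ℕ, B.Infinite →
      ¬ (∀ b₁ ∈ B, ∀ b₂ ∈ B, b₁ < b₂ → ¬ (ℓ + m) ∣ (m * b₁ + ℓ * b₂)) := by
  refine ⟨fun A hA => main_part ℓ m hℓ hm A hA, ?_, fun B hB => optimal_part ℓ m hℓ B hB⟩
  have := density_part (ℓ + m) (by omega)
  push_cast at this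
  exact this
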